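/- Let d ≥ 2, let τ_d : ℝ^d → ℝ^d be the reflection negating the last coordinate, and let w be a doubling weight on S^{d-1} with w(S^{d-1}) = 1 and w(x τ_d) = w(x) for all x ∈ S^{d-1}. Then there exists a constant K_w > 0, depending only on d and the doubling constant of w, such that for every positive integer n and every even integer N satisfying N ≥ K_w / w(B(x, 1/n)) for all x ∈ S^{d-1}, there exists a set Λ = {z_1, …, z_N} of N distinct points of S^{d-1} with ∫_{S^{d-1}} P(x) w(x) dσ_d(x) = (1/N) · Σ_{j=1}^N P(z_j) for every P ∈ Π_n^d, such that Λ is τ_d-invariant (i.e. {z τ_d : z ∈ Λ} = Λ) and every z ∈ Λ has all d coordinates nonzero. -/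

import Mathlib

open MeasureTheory Real Set
open scoped InnerProductSpace

noncomputable section

variable {d : ℕ}

/-- The unit sphere `S^{d-1}` of `ℝ^d`. -/
def unitSphere (d : ℕ) : Set (EuclideanSpace ℝ (Fin d)) :=
  Metric.sphere (0 : EuclideanSpace ℝ (Fin d)) 1

/-- The geodesic distance `dist(x,y) = arccos (x ⬝ y)`. -/
def gdist (x y : EuclideanSpace ℝ (Fin d)) : ℝ := Real.arccos ⟪x, y⟫_ℝ

/-- The spherical cap with center `x` and radius `r`. -/
def cap (x : EuclideanSpace ℝ (Fin d)) (r : ℝ) : Set (EuclideanSpace ℝ (Fin d)) :=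
  {y ∈ unitSphere d | gdist x y ≤ r}

/-- The surface Lebesgue measure on the unit sphere, realized as the
`(d-1)`-dimensional Hausdorff measure restricted to the sphere. -/
def sphMeasure (d : ℕ) : Measure (EuclideanSpace ℝ (Fin d)) :=
  (Measure.hausdorffMeasure ((d : ℝ) - 1)).restrict (unitSphere d)

/-- `w(A) = ∫_A w dσ_d`. -/
def wMass (w : EuclideanSpace ℝ (Fin d) → ℝ) (A : Set (EuclideanSpace ℝ (Fin d))) : ℝ :=
  ∫ x in A, w x ∂(sphMeasure d)

/-- Evaluation of a `d`-variate real polynomial at a point of `ℝ^d`. -/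
def pEval (P : MvPolynomial (Fin d) ℝ) (x : EuclideanSpace ℝ (Fin d)) : ℝ :=
  MvPolynomial.eval (fun i => x i) P

/-- The geodesic arc joining `x` and `y`. -/
def arcSeg (x y : EuclideanSpace ℝ (Fin d)) : Set (EuclideanSpace ℝ (Fin d)) :=
  {z ∈ unitSphere d | ∃ t₁ t₂ : ℝ, 0 ≤ t₁ ∧ 0 ≤ t₂ ∧ z = t₁ • x + t₂ • y}

/-- Geodesic convexity of a subset of the sphere. -/
def GeoConvex (A : Set (EuclideanSpace ℝ (Fin d))) : Prop :=
  ∀ x ∈ A, ∀ y ∈ A, arcSeg x y ⊆ A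

/-- The interior of a subset of the sphere relative to the sphere. -/
def sphInterior (A : Set (EuclideanSpace ℝ (Fin d))) : Set (EuclideanSpace ℝ (Fin d)) :=
  {x ∈ A | ∃ ε : ℝ, 0 < ε ∧ Metric.ball x ε ∩ unitSphere d ⊆ A}

/-- The geodesic simplex spanned by `ξ 0, …, ξ (d-1)`. -/
def geodSimplex (ξ : Fin d → EuclideanSpace ℝ (Fin d)) :
    Set (EuclideanSpace ℝ (Fin d)) :=
  {z | ∃ t : Fin d → ℝ, (∀ j, 0 ≤ t j) ∧ (∑ j, t j) = 1 ∧
    z = ‖∑ j, t j • ξ j‖⁻¹ • ∑ j, t j • ξ j}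

/-- An admissible family `ξ 0, …, ξ (d-1)` of points of the sphere (the indices
`0, 1, …, d-1` correspond to `ξ_1, ξ_2, …, ξ_d` in the paper). -/
def Admissible (ξ : Fin d → EuclideanSpace ℝ (Fin d)) : Prop :=
  LinearIndependent ℝ ξ ∧ (∀ j, ξ j ∈ unitSphere d) ∧
  (∀ i j : Fin d, 1 ≤ (i : ℕ) → 1 ≤ (j : ℕ) → i ≠ j → ⟪ξ i, ξ j⟫_ℝ = 0) ∧
  (∀ i j : Fin d, (i : ℕ) = 0 → (j : ℕ) = 1 →
    Real.arccos ⟪ξ i, ξ j⟫_ℝ ∈ Set.Icc (π / 6) (π / 2)) ∧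
  (∀ i j : Fin d, (i : ℕ) = 0 → 2 ≤ (j : ℕ) → ⟪ξ i, ξ j⟫_ℝ = 0)

/-- A strongly `ε`-separated family of points of the sphere. -/
def StronglySep (ε : ℝ) (η : Fin d → EuclideanSpace ℝ (Fin d)) : Prop :=
  Function.Injective η ∧ (∀ j, η j ∈ unitSphere d) ∧
  ∀ j : Fin d, ∀ y ∈ Submodule.span ℝ (η '' {i | i ≠ j}), ε ≤ ‖η j - y‖

/-- The reflection negating the last coordinate. -/
def lastNeg (d : ℕ) (x : EuclideanSpace ℝ (Fin d)) : EuclideanSpace ℝ (Fin d) :=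
  (EuclideanSpace.equiv (Fin d) ℝ).symm fun i => if (i : ℕ) = d - 1 then -(x i) else x i

/-- The gradient of a `d`-variate polynomial, as a vector of `ℝ^d`. -/
def polyGrad (P : MvPolynomial (Fin d) ℝ) (x : EuclideanSpace ℝ (Fin d)) :
    EuclideanSpace ℝ (Fin d) :=
  (EuclideanSpace.equiv (Fin d) ℝ).symm fun i =>
    MvPolynomial.eval (fun j => x j) (MvPolynomial.pderiv i P)

/-- The tangential gradient `∇₀P(x) = ∇P(x) − (x⬝∇P(x))·x`. -/
def tGrad (P : MvPolynomial (Fin d) ℝ) (x : EuclideanSpace ℝ (Fin d)) :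
    EuclideanSpace ℝ (Fin d) :=
  polyGrad P x - ⟪x, polyGrad P x⟫_ℝ • x

/-- The affine hyperplane through the points `ξ j`. -/
def hplane (ξ : Fin d → EuclideanSpace ℝ (Fin d)) : Set (EuclideanSpace ℝ (Fin d)) :=
  (affineSpan ℝ (Set.range ξ) : Set (EuclideanSpace ℝ (Fin d)))

/-- The ball `B(x,r)_H = {y ∈ H : ‖x − y‖ ≤ r}` in a hyperplane `H`. -/
def ballH (H : Set (EuclideanSpace ℝ (Fin d))) (x : EuclideanSpace ℝ (Fin d)) (r : ℝ) :
    Set (EuclideanSpace ℝ (Fin d)) :=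
  {y ∈ H | ‖x - y‖ ≤ r}

/-- `w(A) = ∫_A w` with respect to `(d−1)`-dimensional Hausdorff (surface) measure. -/
def hMass (w : EuclideanSpace ℝ (Fin d) → ℝ) (A : Set (EuclideanSpace ℝ (Fin d))) : ℝ :=
  ∫ x in A, w x ∂(Measure.hausdorffMeasure ((d : ℝ) - 1))

/-- The interior of `A` relative to a hyperplane `H`. -/
def hInterior (H A : Set (EuclideanSpace ℝ (Fin d))) : Set (EuclideanSpace ℝ (Fin d)) :=
  {x ∈ A | ∃ ε : ℝ, 0 < ε ∧ Metric.ball x ε ∩ H ⊆ A}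

/-- A complex polynomial of degree at most `D` bounded by `B` on the unit circle is bounded by
`B ‖z‖ ^ D` outside the unit disc. -/
lemma norm_eval_le_of_one_le_norm {q : Polynomial ℂ} {D : ℕ} (hq : q.natDegree ≤ D) {B : ℝ}
    (hB : ∀ z : ℂ, ‖z‖ = 1 → ‖q.eval z‖ ≤ B) {z : ℂ} (hz : 1 ≤ ‖z‖) :
    ‖q.eval z‖ ≤ B * ‖z‖ ^ D := by
  have key : ∀ u : ℂ, u ≠ 0 → (q.reflect D).eval u⁻¹ * u ^ D = q.eval u := by
    intro u hu
    let : Invertible u := invertibleOfNonzero hu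
    have := Polynomial.eval₂_reflect_mul_pow (RingHom.id ℂ) u D q hq
    simpa [Polynomial.eval₂_id, invOf_eq_inv] using this
  have hz0 : z ≠ 0 := by
    rintro rfl
    simp at hz
    linarith
  have hmax : ‖(q.reflect D).eval z⁻¹‖ ≤ B := by
    refine Complex.norm_le_of_forall_mem_frontier_norm_le
      (f := fun u => (q.reflect D).eval u) (U := Metric.ball 0 1) Metric.isBounded_ball
      (q.reflect D).differentiable.diffContOnCl ?_ ?_
    · intro u hu
      rw [frontier_ball (0 : ℂ) one_ne_zero, mem_sphere_zero_iff_norm] at hu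
      have hu0 : u⁻¹ ≠ 0 := by
        refine inv_ne_zero ?_
        rintro rfl
        simp at hu
      have h1 : ‖u⁻¹‖ = 1 := by simp [hu]
      have h2 := key _ hu0
      have h3 := hB _ h1
      rw [← h2, norm_mul, norm_pow, h1, inv_inv] at h3
      simpa using h3
    · rw [closure_ball (0 : ℂ) one_ne_zero, mem_closedBall_zero_iff, norm_inv]
      exact inv_le_one_of_one_le₀ hz
  rw [← key z hz0, norm_mul, norm_pow]
  gcongr

/-- A crude Bernstein inequality for complex polynomials on the unit circle. -/
lemma norm_eval_derivative_one_le {q : Polynomial ℂ} {D : ℕ} (hD : 0 < D) (hq : q.natDegree ≤ D)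
    {B : ℝ} (hB : ∀ z : ℂ, ‖z‖ = 1 → ‖q.eval z‖ ≤ B) :
    ‖q.derivative.eval 1‖ ≤ 3 * D * B := by
  have hD' : (0 : ℝ) < D := by exact_mod_cast hD
  have hB0 : 0 ≤ B := (norm_nonneg _).trans (hB 1 (by simp))
  have hexp : (1 + (D : ℝ)⁻¹) ^ D ≤ 3 := by
    calc (1 + (D : ℝ)⁻¹) ^ D ≤ (Real.exp (D : ℝ)⁻¹) ^ D := by
          gcongr
          linarith [Real.add_one_le_exp (D : ℝ)⁻¹]
      _ = Real.exp 1 := by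
          rw [← Real.exp_nat_mul, mul_inv_cancel₀ hD'.ne']
      _ ≤ 3 := by linarith [Real.exp_one_lt_d9]
  have h := Complex.norm_deriv_le_of_forall_mem_sphere_norm_le (f := fun u => q.eval u)
    (c := 1) (R := (D : ℝ)⁻¹) (C := 3 * B) (by positivity)
    q.differentiable.diffContOnCl ?_
  · rw [Polynomial.deriv] at h
    calc _ ≤ 3 * B / (D : ℝ)⁻¹ := h
      _ = 3 * D * B := by rw [div_inv_eq_mul]; ring
  · intro z hz
    rw [mem_sphere_iff_norm] at hz
    have hzn : ‖z‖ ≤ 1 + (D : ℝ)⁻¹ := by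
      calc ‖z‖ = ‖1 + (z - 1)‖ := by ring_nf
        _ ≤ ‖(1 : ℂ)‖ + ‖z - 1‖ := norm_add_le _ _
        _ = _ := by rw [hz, norm_one]
    -- the closed disc is handled by the maximum principle
    rcases le_total 1 ‖z‖ with h1 | h1
    · calc ‖q.eval z‖ ≤ B * ‖z‖ ^ D := norm_eval_le_of_one_le_norm hq hB h1
        _ ≤ B * (1 + (D : ℝ)⁻¹) ^ D := by gcongr
        _ ≤ B * 3 := by gcongr
        _ = 3 * B := by ring
    · have : ‖q.eval z‖ ≤ B := by
        refine Complex.norm_le_of_forall_mem_frontier_norm_le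
          (f := fun u => q.eval u) (U := Metric.ball 0 1) Metric.isBounded_ball
          q.differentiable.diffContOnCl ?_ ?_
        · intro u hu
          rw [frontier_ball (0 : ℂ) one_ne_zero, mem_sphere_zero_iff_norm] at hu
          exact hB u hu
        · rwa [closure_ball (0 : ℂ) one_ne_zero, mem_closedBall_zero_iff]
      linarith

/-- A localized Bernstein inequality: the derivative at `1` is controlled by the values of the
polynomial weighted by an arbitrary power of the scaled distance to `1`. -/
lemma norm_eval_derivative_one_le_of_growth {p : Polynomial ℂ} {n : ℕ} (hn : 0 < n) (M : ℕ)
    (hp : p.natDegree ≤ 2 * n) {B : ℝ}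
    (hB : ∀ z : ℂ, ‖z‖ = 1 → ‖p.eval z‖ ≤ B * (1 + n * ‖z - 1‖) ^ M) :
    ‖p.derivative.eval 1‖ ≤ (3 * (M + 2) * 3 ^ M + M) * n * B := by
  have hn' : (0 : ℝ) < n := by exact_mod_cast hn
  have hnC : (n : ℂ) ≠ 0 := by exact_mod_cast hn.ne'
  have hp1 : ‖p.eval 1‖ ≤ B := by simpa using hB 1 (by simp)
  have hB0 : 0 ≤ B := (norm_nonneg _).trans hp1
  set g : Polynomial ℂ := Polynomial.C (n : ℂ)⁻¹ * ∑ j ∈ Finset.range n, Polynomial.X ^ j with hg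
  have hgdeg : g.natDegree ≤ n := by
    refine (Polynomial.natDegree_C_mul_le _ _).trans ?_
    refine Polynomial.natDegree_sum_le_of_forall_le _ _ fun j hj => ?_
    rw [Polynomial.natDegree_X_pow]
    exact (Finset.mem_range.1 hj).le
  have hgeval : ∀ z, g.eval z = (n : ℂ)⁻¹ * ∑ j ∈ Finset.range n, z ^ j := by
    intro z
    simp [hg, Polynomial.eval_finsetSum]
  have hg1 : g.eval 1 = 1 := by
    rw [hgeval]
    simp [hnC]
  have hgle : ∀ z : ℂ, ‖z‖ = 1 → ‖g.eval z‖ ≤ 1 := by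
    intro z hz
    rw [hgeval, norm_mul, norm_inv, Complex.norm_natCast]
    rw [inv_mul_le_one₀ hn']
    refine (norm_sum_le _ _).trans ?_
    simp [hz]
  have hgdecay : ∀ z : ℂ, ‖z‖ = 1 → ‖g.eval z‖ * (1 + n * ‖z - 1‖) ≤ 3 := by
    intro z hz
    have h1 : ‖g.eval z‖ * (n * ‖z - 1‖) ≤ 2 := by
      have h2 : g.eval z * (n * (z - 1)) = z ^ n - 1 := by
        rw [hgeval, ← geom_sum_mul]
        field_simp
      calc ‖g.eval z‖ * (n * ‖z - 1‖) = ‖g.eval z * (n * (z - 1))‖ := by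
            simp
        _ = ‖z ^ n - 1‖ := by rw [h2]
        _ ≤ ‖z ^ n‖ + ‖(1 : ℂ)‖ := norm_sub_le _ _
        _ = 2 := by rw [norm_pow, hz]; norm_num
    nlinarith [hgle z hz]
  have hgder : ‖g.derivative.eval 1‖ ≤ n := by
    have : g.derivative.eval 1 = (n : ℂ)⁻¹ * ∑ j ∈ Finset.range n, (j : ℂ) := by
      rw [hg, Polynomial.derivative_C_mul, Polynomial.derivative_sum, Polynomial.eval_mul,
        Polynomial.eval_C, Polynomial.eval_finsetSum]
      simp [Polynomial.derivative_X_pow]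
    rw [this, norm_mul, norm_inv, Complex.norm_natCast, inv_mul_le_iff₀ hn']
    refine (norm_sum_le _ _).trans ?_
    calc ∑ j ∈ Finset.range n, ‖(j : ℂ)‖ ≤ ∑ j ∈ Finset.range n, (n : ℝ) := by
          refine Finset.sum_le_sum fun j hj => ?_
          rw [Complex.norm_natCast]
          exact_mod_cast (Finset.mem_range.1 hj).le
      _ = n * n := by simp
  set q := p * g ^ M with hqdef
  have hqdeg : q.natDegree ≤ (M + 2) * n := by
    refine Polynomial.natDegree_mul_le.trans ?_
    have := Polynomial.natDegree_pow_le_of_le M hgdeg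
    nlinarith
  have hqB : ∀ z : ℂ, ‖z‖ = 1 → ‖q.eval z‖ ≤ 3 ^ M * B := by
    intro z hz
    rw [hqdef, Polynomial.eval_mul, Polynomial.eval_pow, norm_mul, norm_pow]
    calc ‖p.eval z‖ * ‖g.eval z‖ ^ M
        ≤ (B * (1 + n * ‖z - 1‖) ^ M) * ‖g.eval z‖ ^ M := by
          gcongr
          exact hB z hz
      _ = B * (‖g.eval z‖ * (1 + n * ‖z - 1‖)) ^ M := by rw [mul_pow]; ring
      _ ≤ B * 3 ^ M := by
          gcongr
          exact hgdecay z hz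
      _ = 3 ^ M * B := by ring
  have hq' := norm_eval_derivative_one_le (D := (M + 2) * n) (by positivity) hqdeg hqB
  have hder : p.derivative.eval 1
      = q.derivative.eval 1 - p.eval 1 * (M * g.derivative.eval 1) := by
    rw [hqdef, Polynomial.derivative_mul, Polynomial.derivative_pow]
    simp [hg1]
  rw [hder]
  calc _ ≤ ‖q.derivative.eval 1‖ + ‖p.eval 1 * (M * g.derivative.eval 1)‖ := norm_sub_le _ _
    _ ≤ 3 * ((M + 2) * n : ℕ) * (3 ^ M * B) + B * (M * n) := by
        gcongr
        rw [norm_mul, norm_mul, Complex.norm_natCast]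
        gcongr
    _ = _ := by push_cast; ring

/-- The great circle `θ ↦ cos θ • x + sin θ • v`. -/
def circ (x v : EuclideanSpace ℝ (Fin d)) (θ : ℝ) : EuclideanSpace ℝ (Fin d) :=
  Real.cos θ • x + Real.sin θ • v

lemma circ_apply (x v : EuclideanSpace ℝ (Fin d)) (θ : ℝ) (i : Fin d) :
    circ x v θ i = Real.cos θ * x i + Real.sin θ * v i := by
  simp [circ]

lemma circ_zero (x v : EuclideanSpace ℝ (Fin d)) : circ x v 0 = x := by
  simp [circ]

lemma inner_circ {x v : EuclideanSpace ℝ (Fin d)} (hx : ‖x‖ = 1) (hxv : ⟪x, v⟫_ℝ = 0) (θ : ℝ) :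
    ⟪x, circ x v θ⟫_ℝ = Real.cos θ := by
  simp [circ, inner_add_right, inner_smul_right, hx, hxv]

lemma norm_circ {x v : EuclideanSpace ℝ (Fin d)} (hx : ‖x‖ = 1) (hv : ‖v‖ = 1)
    (hxv : ⟪x, v⟫_ℝ = 0) (θ : ℝ) : ‖circ x v θ‖ = 1 := by
  have h : ‖circ x v θ‖ ^ 2 = 1 := by
    rw [circ, norm_add_sq_real, norm_smul, norm_smul, inner_smul_left, inner_smul_right, hxv, hx,
      hv]
    simp
  nlinarith [norm_nonneg (circ x v θ)]

lemma norm_sub_circ_sq {x v : EuclideanSpace ℝ (Fin d)} (hx : ‖x‖ = 1) (hv : ‖v‖ = 1)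
    (hxv : ⟪x, v⟫_ℝ = 0) (θ : ℝ) : ‖x - circ x v θ‖ ^ 2 = 2 - 2 * Real.cos θ := by
  rw [norm_sub_sq_real, inner_circ hx hxv, norm_circ hx hv hxv, hx]
  ring

lemma norm_sub_circ_le {x v : EuclideanSpace ℝ (Fin d)} (hx : ‖x‖ = 1) (hv : ‖v‖ = 1)
    (hxv : ⟪x, v⟫_ℝ = 0) (θ : ℝ) : ‖x - circ x v θ‖ ≤ |θ| := by
  refine abs_le_of_sq_le_sq' ?_ (abs_nonneg θ) |>.2
  rw [norm_sub_circ_sq hx hv hxv, sq_abs]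
  linarith [Real.one_sub_sq_div_two_le_cos (x := θ)]

lemma circ_circ {x v : EuclideanSpace ℝ (Fin d)} (s θ : ℝ) :
    circ (circ x v s) (circ v (-x) s) θ = circ x v (s + θ) := by
  ext i
  simp only [circ_apply, PiLp.neg_apply, Real.cos_add, Real.sin_add]
  ring

lemma norm_exp_sub_one_sq (θ : ℝ) :
    ‖Complex.exp (θ * Complex.I) - 1‖ ^ 2 = 2 - 2 * Real.cos θ := by
  rw [← Complex.normSq_eq_norm_sq, Complex.normSq_apply]
  simp [Complex.exp_ofReal_mul_I_re, Complex.exp_ofReal_mul_I_im]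
  nlinarith [Real.sin_sq_add_cos_sq θ]

/-- On a great circle, a polynomial of degree at most `n` is a trigonometric polynomial of degree
at most `n`. -/
lemma exists_polynomial_eval_exp (P : MvPolynomial (Fin d) ℝ) {n : ℕ} (hP : P.totalDegree ≤ n)
    (x v : EuclideanSpace ℝ (Fin d)) :
    ∃ p : Polynomial ℂ, p.natDegree ≤ 2 * n ∧ ∀ θ : ℝ,
      p.eval (Complex.exp (θ * Complex.I))
        = Complex.exp (θ * Complex.I) ^ n * (pEval P (circ x v θ) : ℂ) := by
  set l : Fin d → Polynomial ℂ := fun i =>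
    Polynomial.C (((x i : ℂ) - Complex.I * v i) / 2) * Polynomial.X ^ 2
      + Polynomial.C (((x i : ℂ) + Complex.I * v i) / 2) with hl
  have hldeg : ∀ i, (l i).natDegree ≤ 2 := fun i => by
    refine Polynomial.natDegree_add_le_of_degree_le (Polynomial.natDegree_C_mul_X_pow_le _ _) ?_
    rw [Polynomial.natDegree_C]
    norm_num
  have hleval : ∀ i (θ : ℝ), (l i).eval (Complex.exp (θ * Complex.I))
      = Complex.exp (θ * Complex.I) * (circ x v θ i : ℂ) := by
    intro i θ
    rw [circ_apply]
    simp only [hl, Polynomial.eval_add, Polynomial.eval_mul, Polynomial.eval_C,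
      Polynomial.eval_pow, Polynomial.eval_X]
    push_cast
    rw [Complex.exp_mul_I]
    have h := Complex.sin_sq_add_cos_sq (θ : ℂ)
    have hI := Complex.I_sq
    linear_combination ((x i : ℂ) + Complex.I * v i) / 2 * (-h)
      + (x i * Complex.sin θ ^ 2 / 2 - Complex.I * v i * Complex.sin θ ^ 2 / 2
        - Complex.cos θ * v i * Complex.sin θ ) * hI
  have hsum : ∀ s ∈ P.support, ∑ i, s i ≤ n := fun s hs => by
    have := MvPolynomial.le_totalDegree hs
    rw [Finsupp.sum_fintype _ _ (fun _ => rfl)] at this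
    exact this.trans hP
  refine ⟨∑ s ∈ P.support, Polynomial.C ((P.coeff s : ℝ) : ℂ) * (∏ i, l i ^ s i)
      * Polynomial.X ^ (n - ∑ i, s i), ?_, ?_⟩
  · refine Polynomial.natDegree_sum_le_of_forall_le _ _ fun s hs => ?_
    refine Polynomial.natDegree_mul_le.trans ?_
    rw [Polynomial.natDegree_X_pow]
    have h1 : (∏ i, l i ^ s i).natDegree ≤ ∑ i, s i * 2 :=
      (Polynomial.natDegree_prod_le _ _).trans
        (Finset.sum_le_sum fun i _ => Polynomial.natDegree_pow_le_of_le _ (hldeg i))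
    rw [← Finset.sum_mul] at h1
    have h2 := Polynomial.natDegree_C_mul_le ((P.coeff s : ℝ) : ℂ) (∏ i, l i ^ s i)
    have h3 := hsum s hs
    omega
  · intro θ
    rw [pEval, MvPolynomial.eval_eq', Polynomial.eval_finsetSum]
    push_cast
    rw [Finset.mul_sum]
    refine Finset.sum_congr rfl fun s hs => ?_
    rw [Polynomial.eval_mul, Polynomial.eval_mul, Polynomial.eval_prod, Polynomial.eval_C,
      Polynomial.eval_pow, Polynomial.eval_X]
    simp only [Polynomial.eval_pow, hleval, mul_pow, Finset.prod_mul_distrib,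
      Finset.prod_pow_eq_pow_sum]
    rw [← Nat.add_sub_cancel' (hsum s hs), pow_add, Nat.add_sub_cancel_left]
    ring

/-- The constant in the localized Bernstein inequality. -/
def bernsteinConst (M : ℕ) : ℝ := 3 * (M + 2) * 3 ^ M + M + 1

lemma bernsteinConst_pos (M : ℕ) : 0 < bernsteinConst M := by
  unfold bernsteinConst
  positivity

/-- The localized Bernstein inequality along great circles. -/
lemma abs_deriv_circ_le {n : ℕ} (hn : 0 < n) (M : ℕ) {Q : MvPolynomial (Fin d) ℝ}
    (hQ : Q.totalDegree ≤ n) {x v : EuclideanSpace ℝ (Fin d)} (hx : ‖x‖ = 1) (hv : ‖v‖ = 1)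
    (hxv : ⟪x, v⟫_ℝ = 0) {B : ℝ}
    (hB : ∀ y ∈ unitSphere d, |pEval Q y| ≤ B * (1 + n * ‖x - y‖) ^ M) {f' : ℝ}
    (hf : HasDerivAt (fun θ => pEval Q (circ x v θ)) f' 0) :
    |f'| ≤ bernsteinConst M * n * B := by
  obtain ⟨p, hpdeg, hp⟩ := exists_polynomial_eval_exp Q hQ x v
  have hgrow : ∀ z : ℂ, ‖z‖ = 1 → ‖p.eval z‖ ≤ B * (1 + n * ‖z - 1‖) ^ M := by
    intro z hz
    have hz' : z = Complex.exp (Complex.arg z * Complex.I) := by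
      conv_lhs => rw [← Complex.norm_mul_exp_arg_mul_I z, hz]
      simp
    have hdist : ‖x - circ x v (Complex.arg z)‖ = ‖z - 1‖ := by
      rw [← sq_eq_sq₀ (norm_nonneg _) (norm_nonneg _), norm_sub_circ_sq hx hv hxv]
      conv_rhs => rw [hz']
      rw [norm_exp_sub_one_sq]
    have h1 : ‖p.eval z‖ = |pEval Q (circ x v (Complex.arg z))| := by
      conv_lhs => rw [hz']
      rw [hp, norm_mul, norm_pow, Complex.norm_exp_ofReal_mul_I, Complex.norm_real]
      simp
    rw [h1, ← hdist]
    exact hB _ (by simp [unitSphere, norm_circ hx hv hxv])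
  have h1 := norm_eval_derivative_one_le_of_growth hn M hpdeg hgrow
  have h0 : ‖p.eval 1‖ ≤ B := by simpa using hgrow 1 (by simp)
  have hexp : HasDerivAt (fun θ : ℝ => Complex.exp (θ * Complex.I)) Complex.I 0 := by
    have : HasDerivAt (fun θ : ℝ => (θ : ℂ) * Complex.I) (1 * Complex.I) (0 : ℝ) :=
      (HasDerivAt.ofReal_comp (hasDerivAt_id (0 : ℝ))).mul_const _
    simpa using this.cexp
  have hL : HasDerivAt (fun θ : ℝ => p.eval (Complex.exp (θ * Complex.I)))
      (p.derivative.eval 1 * Complex.I) 0 := by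
    have h2 := p.hasDerivAt (Complex.exp ((0 : ℝ) * Complex.I))
    have := HasDerivAt.comp (0 : ℝ) h2 hexp
    simpa [Function.comp_def] using this
  have hR : HasDerivAt (fun θ : ℝ => Complex.exp (θ * Complex.I) ^ n
      * (pEval Q (circ x v θ) : ℂ)) (n * Complex.I * p.eval 1 + f') 0 := by
    have h2 : HasDerivAt (fun θ : ℝ => Complex.exp (θ * Complex.I) ^ n
      * (pEval Q (circ x v θ) : ℂ)) _ 0 := (hexp.pow n).mul hf.ofReal_comp
    have h3 : p.eval 1 = pEval Q x := by simpa [circ_zero] using hp 0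
    rw [h3]
    simpa [circ_zero] using h2
  have heq : p.derivative.eval 1 * Complex.I = n * Complex.I * p.eval 1 + f' := by
    rw [funext hp] at hL
    exact hL.unique hR
  have h4 : (f' : ℂ) = p.derivative.eval 1 * Complex.I - n * Complex.I * p.eval 1 := by
    rw [heq]
    ring
  have h5 : |f'| = ‖(f' : ℂ)‖ := by simp
  rw [h5, h4]
  calc _ ≤ ‖p.derivative.eval 1 * Complex.I‖ + ‖n * Complex.I * p.eval 1‖ := norm_sub_le _ _
    _ ≤ (3 * (M + 2) * 3 ^ M + M) * n * B + n * B := by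
        simp only [norm_mul, Complex.norm_I, mul_one, Complex.norm_natCast]
        gcongr
    _ = _ := by
        unfold bernsteinConst
        ring

/-- The angular derivative `x_j ∂_k P - x_k ∂_j P`. -/
def angDeriv (j k : Fin d) (P : MvPolynomial (Fin d) ℝ) : MvPolynomial (Fin d) ℝ :=
  MvPolynomial.X j * MvPolynomial.pderiv k P - MvPolynomial.X k * MvPolynomial.pderiv j P

lemma totalDegree_X_mul_pderiv_le {n : ℕ} (j k : Fin d) {P : MvPolynomial (Fin d) ℝ}
    (hP : P.totalDegree ≤ n) :
    (MvPolynomial.X j * MvPolynomial.pderiv k P).totalDegree ≤ n := by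
  conv_lhs => rw [P.as_sum]
  rw [map_sum, Finset.mul_sum]
  refine MvPolynomial.totalDegree_finsetSum_le fun s hs => ?_
  have hs' := (MvPolynomial.le_totalDegree hs).trans hP
  rw [MvPolynomial.pderiv_monomial]
  by_cases hk : s k = 0
  · simp [hk]
  · refine (MvPolynomial.totalDegree_mul _ _).trans ?_
    refine (add_le_add (MvPolynomial.totalDegree_X (R := ℝ) j).le
      (MvPolynomial.totalDegree_monomial_le _ _)).trans ?_
    rw [Finsupp.sum_fintype _ _ (fun _ => rfl)] at hs' ⊢
    have h1 : ∑ i, (s - Finsupp.single k 1 : Fin d →₀ ℕ) i + 1 = ∑ i, s i := by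
      have h2 : ∀ i, s i = (s - Finsupp.single k 1 : Fin d →₀ ℕ) i + (Finsupp.single k 1 : Fin d →₀ ℕ) i := by
        intro i
        rw [Finsupp.tsub_apply]
        by_cases hi : i = k
        · subst hi
          simp
          omega
        · simp [Ne.symm hi]
      conv_rhs => rw [Finset.sum_congr rfl fun i _ => h2 i, Finset.sum_add_distrib]
      simp [Finsupp.single_apply]
    simp only [id]
    omega

lemma totalDegree_angDeriv_le {n : ℕ} (j k : Fin d) {P : MvPolynomial (Fin d) ℝ}
    (hP : P.totalDegree ≤ n) : (angDeriv j k P).totalDegree ≤ n :=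
  (MvPolynomial.totalDegree_sub _ _).trans
    (max_le (totalDegree_X_mul_pderiv_le j k hP) (totalDegree_X_mul_pderiv_le k j hP))

lemma continuous_pEval (P : MvPolynomial (Fin d) ℝ) : Continuous (pEval P) :=
  (MvPolynomial.continuous_eval P).comp (by fun_prop)

lemma pEval_angDeriv (j k : Fin d) (P : MvPolynomial (Fin d) ℝ) (y : EuclideanSpace ℝ (Fin d)) :
    pEval (angDeriv j k P) y
      = y j * pEval (MvPolynomial.pderiv k P) y - y k * pEval (MvPolynomial.pderiv j P) y := by
  simp [pEval, angDeriv]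

/-- The size of the tangential gradient of `P`, measured by the angular derivatives. -/
def gradSize (P : MvPolynomial (Fin d) ℝ) (y : EuclideanSpace ℝ (Fin d)) : ℝ :=
  ∑ j, ∑ k, |pEval (angDeriv j k P) y|

lemma gradSize_nonneg (P : MvPolynomial (Fin d) ℝ) (y : EuclideanSpace ℝ (Fin d)) :
    0 ≤ gradSize P y := by
  unfold gradSize
  positivity

lemma continuous_gradSize (P : MvPolynomial (Fin d) ℝ) : Continuous (gradSize P) := by
  unfold gradSize
  have := fun j k => continuous_pEval (angDeriv j k P)
  fun_prop

lemma abs_angDeriv_le_gradSize (j k : Fin d) (P : MvPolynomial (Fin d) ℝ)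
    (y : EuclideanSpace ℝ (Fin d)) : |pEval (angDeriv j k P) y| ≤ gradSize P y := by
  unfold gradSize
  refine le_trans ?_ (Finset.single_le_sum
    (f := fun j => ∑ k, |pEval (angDeriv j k P) y|) (fun _ _ => by positivity)
    (Finset.mem_univ j))
  exact Finset.single_le_sum (f := fun k => |pEval (angDeriv j k P) y|)
    (fun _ _ => abs_nonneg _) (Finset.mem_univ k)

lemma hasDerivAt_circ (P : MvPolynomial (Fin d) ℝ) (x v : EuclideanSpace ℝ (Fin d)) (t : ℝ) :
    HasDerivAt (fun θ => pEval P (circ x v θ))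
      (∑ k, circ v (-x) t k * pEval (MvPolynomial.pderiv k P) (circ x v t)) t := by
  induction P using MvPolynomial.induction_on with
  | C a => simpa [pEval] using hasDerivAt_const t a
  | add p q hp hq =>
    have := hp.add hq
    simp only [← Finset.sum_add_distrib, ← mul_add] at this
    simpa [pEval, Pi.add_def] using this
  | mul_X p i hp =>
    have hi : HasDerivAt (fun θ => circ x v θ i) (circ v (-x) t i) t := by
      simp only [circ_apply, PiLp.neg_apply]
      have := ((Real.hasDerivAt_cos t).mul_const (x i)).add
        ((Real.hasDerivAt_sin t).mul_const (v i))
      refine this.congr_deriv ?_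
      ring
    have := hp.mul hi
    refine (this.congr_deriv ?_).congr_of_eventuallyEq ?_
    · rw [Finset.sum_mul]
      have h1 : ∀ k, circ v (-x) t k * pEval (MvPolynomial.pderiv k (p * MvPolynomial.X i))
          (circ x v t) = circ v (-x) t k * pEval (MvPolynomial.pderiv k p) (circ x v t)
            * circ x v t i + (if k = i then circ v (-x) t i * pEval p (circ x v t) else 0) := by
        intro k
        by_cases hk : k = i
        · subst hk
          simp [pEval]
          ring
        · simp [pEval, MvPolynomial.pderiv_X_of_ne (Ne.symm hk), hk]
          ring
      rw [Finset.sum_congr rfl fun k _ => h1 k, Finset.sum_add_distrib]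
      simp
      ring
    · exact Filter.Eventually.of_forall fun θ => by simp [pEval]

lemma sum_mul_pderiv_circ (P : MvPolynomial (Fin d) ℝ) {x v : EuclideanSpace ℝ (Fin d)}
    (hx : ‖x‖ = 1) (hv : ‖v‖ = 1) (hxv : ⟪x, v⟫_ℝ = 0) (t : ℝ) :
    ∑ k, circ v (-x) t k * pEval (MvPolynomial.pderiv k P) (circ x v t)
      = ∑ j, ∑ k, x j * v k * pEval (angDeriv j k P) (circ x v t) := by
  have h1 : ∑ j, x j * circ x v t j = Real.cos t := by
    rw [← inner_circ hx hxv t, PiLp.inner_apply]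
    simp [mul_comm]
  have h2 : ∑ j, v j * circ x v t j = Real.sin t := by
    have : ⟪v, circ x v t⟫_ℝ = Real.sin t := by
      rw [circ, inner_add_right, inner_smul_right, inner_smul_right, real_inner_comm, hxv,
        real_inner_self_eq_norm_sq, hv]
      simp
    rw [← this, PiLp.inner_apply]
    simp [mul_comm]
  set D : Fin d → ℝ := fun k => pEval (MvPolynomial.pderiv k P) (circ x v t) with hD
  calc ∑ k, circ v (-x) t k * D k
      = Real.cos t * ∑ k, v k * D k - Real.sin t * ∑ k, x k * D k := by
        rw [Finset.mul_sum, Finset.mul_sum, ← Finset.sum_sub_distrib]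
        refine Finset.sum_congr rfl fun k _ => ?_
        rw [circ_apply, PiLp.neg_apply]
        ring
    _ = ∑ j, ∑ k, x j * v k * (circ x v t j * D k - circ x v t k * D j) := by
        rw [← h1, ← h2, Finset.sum_mul_sum, Finset.sum_mul_sum]
        conv_lhs => rw [sub_eq_add_neg]; arg 2; rw [Finset.sum_comm]
        rw [← sub_eq_add_neg, ← Finset.sum_sub_distrib]
        refine Finset.sum_congr rfl fun j _ => ?_
        rw [← Finset.sum_sub_distrib]
        refine Finset.sum_congr rfl fun k _ => ?_
        ring
    _ = _ := by
        simp only [pEval_angDeriv, hD]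

/-- The Peetre maximal function of the size of the tangential gradient. -/
def gradMax (M n : ℕ) (P : MvPolynomial (Fin d) ℝ) (x : EuclideanSpace ℝ (Fin d)) : ℝ :=
  sSup ((fun y => gradSize P y / (1 + n * ‖x - y‖) ^ M) '' unitSphere d)

lemma one_add_mul_norm_pos (n : ℕ) (x y : EuclideanSpace ℝ (Fin d)) :
    0 < 1 + n * ‖x - y‖ := by
  positivity

lemma one_add_mul_norm_le_mul (n : ℕ) (x u y : EuclideanSpace ℝ (Fin d)) :
    1 + n * ‖x - y‖ ≤ (1 + n * ‖x - u‖) * (1 + n * ‖u - y‖) := by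
  have h : ‖x - y‖ ≤ ‖x - u‖ + ‖u - y‖ := norm_sub_le_norm_sub_add_norm_sub x u y
  have h1 : (n : ℝ) * ‖x - y‖ ≤ n * (‖x - u‖ + ‖u - y‖) := by gcongr
  have h2 : 0 ≤ (n * ‖x - u‖) * (n * ‖u - y‖) := by positivity
  linarith

lemma continuousOn_gradSize_div (M n : ℕ) (P : MvPolynomial (Fin d) ℝ)
    (x : EuclideanSpace ℝ (Fin d)) :
    ContinuousOn (fun y => gradSize P y / (1 + n * ‖x - y‖) ^ M) (unitSphere d) := by
  refine (Continuous.div (continuous_gradSize P) (by fun_prop) fun y => ?_).continuousOn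
  have := one_add_mul_norm_pos n x y
  positivity

lemma isCompact_unitSphere : IsCompact (unitSphere d) := isCompact_sphere _ _

lemma gradSize_le_gradMax (M n : ℕ) (P : MvPolynomial (Fin d) ℝ)
    (x : EuclideanSpace ℝ (Fin d)) {y : EuclideanSpace ℝ (Fin d)} (hy : y ∈ unitSphere d) :
    gradSize P y ≤ gradMax M n P x * (1 + n * ‖x - y‖) ^ M := by
  have := one_add_mul_norm_pos n x y
  rw [← div_le_iff₀ (by positivity)]
  exact le_csSup (isCompact_unitSphere.image_of_continuousOn
    (continuousOn_gradSize_div M n P x)).bddAbove (mem_image_of_mem _ hy)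

lemma exists_gradMax_eq (M n : ℕ) (P : MvPolynomial (Fin d) ℝ)
    {x : EuclideanSpace ℝ (Fin d)} (hx : x ∈ unitSphere d) :
    ∃ y ∈ unitSphere d, gradMax M n P x = gradSize P y / (1 + n * ‖x - y‖) ^ M :=
  isCompact_unitSphere.exists_sSup_image_eq ⟨x, hx⟩ (continuousOn_gradSize_div M n P x)

lemma gradMax_nonneg (M n : ℕ) (P : MvPolynomial (Fin d) ℝ) (x : EuclideanSpace ℝ (Fin d)) :
    0 ≤ gradMax M n P x := by
  refine Real.sSup_nonneg ?_
  rintro _ ⟨y, _, rfl⟩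
  have := one_add_mul_norm_pos n x y
  have := gradSize_nonneg P y
  positivity

lemma gradMax_le (M n : ℕ) (P : MvPolynomial (Fin d) ℝ)
    {x : EuclideanSpace ℝ (Fin d)} (hx : x ∈ unitSphere d) (u : EuclideanSpace ℝ (Fin d)) :
    gradMax M n P x ≤ (1 + n * ‖x - u‖) ^ M * gradMax M n P u := by
  obtain ⟨y, hy, h⟩ := exists_gradMax_eq M n P hx
  have h0 := one_add_mul_norm_pos n x y
  rw [h, div_le_iff₀ (by positivity)]
  have hM := gradMax_nonneg M n P u
  calc gradSize P y ≤ gradMax M n P u * (1 + n * ‖u - y‖) ^ M := gradSize_le_gradMax M n P u hy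
    _ ≤ gradMax M n P u * ((1 + n * ‖u - x‖) * (1 + n * ‖x - y‖)) ^ M := by
        gcongr
        exact one_add_mul_norm_le_mul n u x y
    _ = _ := by rw [mul_pow, norm_sub_rev u x]; ring

lemma abs_sub_le_of_hasDerivAt {f f' : ℝ → ℝ} {C θ : ℝ} (hf : ∀ t, HasDerivAt f (f' t) t)
    (hC : ∀ t, |t| ≤ |θ| → |f' t| ≤ C) : |f θ - f 0| ≤ C * |θ| := by
  have := Convex.norm_image_sub_le_of_norm_hasDerivWithin_le (f := f) (f' := f')
    (s := Icc (-|θ|) |θ|) (x := 0) (y := θ) (C := C)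
    (fun t _ => (hf t).hasDerivWithinAt) (fun t ht => hC t (abs_le.2 ht)) (convex_Icc _ _)
    (by simp) (abs_le.1 le_rfl)
  simpa using this

lemma inner_circ_circ {x v : EuclideanSpace ℝ (Fin d)} (hx : ‖x‖ = 1) (hv : ‖v‖ = 1)
    (hxv : ⟪x, v⟫_ℝ = 0) (t : ℝ) : ⟪circ x v t, circ v (-x) t⟫_ℝ = 0 := by
  simp only [circ, inner_add_left, inner_add_right, inner_smul_left, inner_smul_right,
    inner_neg_right, real_inner_self_eq_norm_sq, real_inner_comm x v, hxv, hx, hv]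
  simp
  ring

lemma norm_circ_neg {x v : EuclideanSpace ℝ (Fin d)} (hx : ‖x‖ = 1) (hv : ‖v‖ = 1)
    (hxv : ⟪x, v⟫_ℝ = 0) (t : ℝ) : ‖circ v (-x) t‖ = 1 :=
  norm_circ hv (by rwa [norm_neg]) (by rw [inner_neg_right, real_inner_comm, hxv, neg_zero]) t

lemma one_add_mul_norm_circ_le {n : ℕ} (hn : 0 < n) {x v : EuclideanSpace ℝ (Fin d)}
    (hx : ‖x‖ = 1) (hv : ‖v‖ = 1) (hxv : ⟪x, v⟫_ℝ = 0) {t : ℝ} (ht : |t| ≤ 2 / n) :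
    1 + n * ‖x - circ x v t‖ ≤ 3 := by
  have hn' : (0 : ℝ) < n := by exact_mod_cast hn
  have h := (norm_sub_circ_le hx hv hxv t).trans ht
  have : (n : ℝ) * ‖x - circ x v t‖ ≤ n * (2 / n) := by gcongr
  rw [mul_div_cancel₀ _ hn'.ne'] at this
  linarith

/-- The constant in the local oscillation estimates for polynomials. -/
def oscConst (M : ℕ) : ℝ := bernsteinConst M * 3 ^ M

lemma oscConst_pos (M : ℕ) : 0 < oscConst M := by
  have := bernsteinConst_pos M
  unfold oscConst
  positivity

lemma abs_pEval_circ_sub_le {n : ℕ} (hn : 0 < n) (M : ℕ) {Q : MvPolynomial (Fin d) ℝ}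
    (hQ : Q.totalDegree ≤ n) {x v : EuclideanSpace ℝ (Fin d)} (hx : ‖x‖ = 1) (hv : ‖v‖ = 1)
    (hxv : ⟪x, v⟫_ℝ = 0) {B : ℝ}
    (hB : ∀ y ∈ unitSphere d, |pEval Q y| ≤ B * (1 + n * ‖x - y‖) ^ M) {θ : ℝ}
    (hθ : |θ| ≤ 2 / n) : |pEval Q (circ x v θ) - pEval Q x| ≤ oscConst M * n * B * |θ| := by
  have hB0 : 0 ≤ B := by
    have := hB x (by simpa [unitSphere] using hx)
    simp only [sub_self, norm_zero, mul_zero, add_zero, one_pow, mul_one] at this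
    exact (abs_nonneg _).trans this
  have key := abs_sub_le_of_hasDerivAt (θ := θ) (C := oscConst M * n * B)
    (fun t => hasDerivAt_circ Q x v t) ?_
  · simpa [circ_zero] using key
  · intro t ht
    have h3 := one_add_mul_norm_circ_le hn hx hv hxv (ht.trans hθ)
    have hd : HasDerivAt (fun s => pEval Q (circ (circ x v t) (circ v (-x) t) s))
        (∑ k, circ v (-x) t k * pEval (MvPolynomial.pderiv k Q) (circ x v t)) 0 := by
      simp only [circ_circ]
      have h1 := hasDerivAt_circ Q x v (t + 0)
      have h2 := h1.comp_const_add t 0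
      simpa using h2
    have := abs_deriv_circ_le hn M hQ (norm_circ hx hv hxv t) (norm_circ_neg hx hv hxv t)
      (inner_circ_circ hx hv hxv t) (B := B * 3 ^ M) (fun y hy => ?_) hd
    · refine this.trans_eq ?_
      unfold oscConst
      ring
    · refine (hB y hy).trans ?_
      rw [mul_assoc, ← mul_pow]
      gcongr
      refine (one_add_mul_norm_le_mul n x (circ x v t) y).trans ?_
      gcongr

lemma abs_apply_le_one {x : EuclideanSpace ℝ (Fin d)} (hx : ‖x‖ = 1) (j : Fin d) :
    |x j| ≤ 1 := by
  rw [← hx, ← Real.norm_eq_abs]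
  exact PiLp.norm_apply_le x j

lemma gradSize_circ_le {n : ℕ} (hn : 0 < n) (M : ℕ) (P : MvPolynomial (Fin d) ℝ)
    {x v : EuclideanSpace ℝ (Fin d)} (hx : ‖x‖ = 1) (hv : ‖v‖ = 1)
    (hxv : ⟪x, v⟫_ℝ = 0) {t : ℝ} (ht : |t| ≤ 2 / n) :
    gradSize P (circ x v t) ≤ 3 ^ M * gradMax M n P x := by
  have h0 := gradMax_nonneg M n P x
  refine (gradSize_le_gradMax M n P x (y := circ x v t)
    (by simpa [unitSphere] using norm_circ hx hv hxv t)).trans ?_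
  rw [mul_comm]
  gcongr
  exact one_add_mul_norm_circ_le hn hx hv hxv ht

lemma abs_sum_sum_mul_le {x v : EuclideanSpace ℝ (Fin d)} (hx : ‖x‖ = 1) (hv : ‖v‖ = 1)
    (D : Fin d → Fin d → ℝ) : |∑ j, ∑ k, x j * v k * D j k| ≤ ∑ j, ∑ k, |D j k| := by
  refine (Finset.abs_sum_le_sum_abs _ _).trans (Finset.sum_le_sum fun j _ => ?_)
  refine (Finset.abs_sum_le_sum_abs _ _).trans (Finset.sum_le_sum fun k _ => ?_)
  rw [abs_mul, abs_mul]
  have h1 := abs_apply_le_one hx j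
  have h2 := abs_apply_le_one hv k
  have h3 := mul_le_one₀ h1 (abs_nonneg _) h2
  exact mul_le_of_le_one_left (abs_nonneg _) h3

lemma abs_pEval_circ_sub_le_gradMax {n : ℕ} (hn : 0 < n) (M : ℕ) (P : MvPolynomial (Fin d) ℝ)
    {x v : EuclideanSpace ℝ (Fin d)} (hx : ‖x‖ = 1) (hv : ‖v‖ = 1)
    (hxv : ⟪x, v⟫_ℝ = 0) {θ : ℝ} (hθ : |θ| ≤ 2 / n) :
    |pEval P (circ x v θ) - pEval P x| ≤ 3 ^ M * gradMax M n P x * |θ| := by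
  have key := abs_sub_le_of_hasDerivAt (θ := θ) (C := 3 ^ M * gradMax M n P x)
    (fun t => hasDerivAt_circ P x v t) ?_
  · simpa [circ_zero] using key
  · intro t ht
    rw [sum_mul_pderiv_circ P hx hv hxv]
    exact (abs_sum_sum_mul_le hx hv _).trans (gradSize_circ_le hn M P hx hv hxv (ht.trans hθ))

lemma abs_angDeriv_circ_sub_le {n : ℕ} (hn : 0 < n) (M : ℕ) {P : MvPolynomial (Fin d) ℝ}
    (hP : P.totalDegree ≤ n) {x v : EuclideanSpace ℝ (Fin d)} (hx : ‖x‖ = 1) (hv : ‖v‖ = 1)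
    (hxv : ⟪x, v⟫_ℝ = 0) {θ : ℝ} (hθ : |θ| ≤ 2 / n) (j k : Fin d) :
    |pEval (angDeriv j k P) (circ x v θ) - pEval (angDeriv j k P) x|
      ≤ oscConst M * n * gradMax M n P x * |θ| :=
  abs_pEval_circ_sub_le hn M (totalDegree_angDeriv_le j k hP) hx hv hxv
    (fun _ hy => (abs_angDeriv_le_gradSize j k P _).trans (gradSize_le_gradMax M n P x hy)) hθ

lemma abs_gradSize_circ_sub_le {n : ℕ} (hn : 0 < n) (M : ℕ) {P : MvPolynomial (Fin d) ℝ}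
    (hP : P.totalDegree ≤ n) {x v : EuclideanSpace ℝ (Fin d)} (hx : ‖x‖ = 1) (hv : ‖v‖ = 1)
    (hxv : ⟪x, v⟫_ℝ = 0) {θ : ℝ} (hθ : |θ| ≤ 2 / n) :
    |gradSize P (circ x v θ) - gradSize P x|
      ≤ d ^ 2 * oscConst M * n * gradMax M n P x * |θ| := by
  unfold gradSize
  simp only [← Finset.sum_sub_distrib]
  refine (Finset.abs_sum_le_sum_abs _ _).trans ((Finset.sum_le_sum fun j _ =>
    (Finset.abs_sum_le_sum_abs _ _).trans (Finset.sum_le_sum fun k _ =>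
      (abs_abs_sub_abs_le_abs_sub _ _).trans
        (abs_angDeriv_circ_sub_le hn M hP hx hv hxv hθ j k))).trans_eq ?_)
  simp
  ring

lemma abs_pEval_circ_sub_sub_le {n : ℕ} (hn : 0 < n) (M : ℕ) {P : MvPolynomial (Fin d) ℝ}
    (hP : P.totalDegree ≤ n) {x v : EuclideanSpace ℝ (Fin d)} (hx : ‖x‖ = 1) (hv : ‖v‖ = 1)
    (hxv : ⟪x, v⟫_ℝ = 0) {θ : ℝ} (hθ : |θ| ≤ 2 / n) :
    |pEval P (circ x v θ) - pEval P x - θ * ∑ k, v k * pEval (MvPolynomial.pderiv k P) x|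
      ≤ d ^ 2 * oscConst M * n * gradMax M n P x * θ ^ 2 := by
  have h0 : ∑ k, v k * pEval (MvPolynomial.pderiv k P) x
      = ∑ j, ∑ k, x j * v k * pEval (angDeriv j k P) x := by
    have := sum_mul_pderiv_circ P hx hv hxv 0
    simpa [circ_zero] using this
  set f' := ∑ k, v k * pEval (MvPolynomial.pderiv k P) x with hf'
  have key := abs_sub_le_of_hasDerivAt (θ := θ)
    (C := d ^ 2 * oscConst M * n * gradMax M n P x * |θ|)
    (fun t => (hasDerivAt_circ P x v t).sub ((hasDerivAt_id t).mul_const f')) ?_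
  · simp only [Pi.sub_apply, circ_zero, id, zero_mul, sub_zero] at key
    rw [sub_right_comm]
    refine key.trans_eq ?_
    rw [mul_assoc, ← sq, sq_abs]
  · intro t ht
    rw [sum_mul_pderiv_circ P hx hv hxv, h0, one_mul]
    simp only [← Finset.sum_sub_distrib, ← mul_sub]
    refine (abs_sum_sum_mul_le hx hv _).trans ((Finset.sum_le_sum fun j _ =>
      Finset.sum_le_sum fun k _ =>
        abs_angDeriv_circ_sub_le hn M hP hx hv hxv (ht.trans hθ) j k).trans ?_)
    have := gradMax_nonneg M n P x
    have := oscConst_pos M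
    simp only [Finset.sum_const, Finset.card_univ, Fintype.card_fin, nsmul_eq_mul]
    calc _ = d ^ 2 * oscConst M * n * gradMax M n P x * |t| := by ring
      _ ≤ _ := by gcongr

/-- Moving a point of the sphere along a tangent vector. -/
lemma exists_move {n : ℕ} (hn : 0 < n) (M : ℕ) {x V : EuclideanSpace ℝ (Fin d)} (hx : ‖x‖ = 1)
    (hxV : ⟪x, V⟫_ℝ = 0) (hV : ‖V‖ ≤ 2 / n) :
    ∃ u ∈ unitSphere d, ‖x - u‖ ≤ ‖V‖ ∧ ∀ P : MvPolynomial (Fin d) ℝ, P.totalDegree ≤ n →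
      |pEval P u - pEval P x - ∑ k, V k * pEval (MvPolynomial.pderiv k P) x|
        ≤ d ^ 2 * oscConst M * n * gradMax M n P x * ‖V‖ ^ 2 := by
  by_cases hV0 : V = 0
  · refine ⟨x, by simpa [unitSphere] using hx, by simp, fun P _ => ?_⟩
    simp [hV0]
  have hV1 : ‖V‖ ≠ 0 := norm_ne_zero_iff.2 hV0
  have hv : ‖‖V‖⁻¹ • V‖ = 1 := by
    rw [norm_smul, norm_inv, norm_norm, inv_mul_cancel₀ hV1]
  have hxv : ⟪x, ‖V‖⁻¹ • V⟫_ℝ = 0 := by rw [inner_smul_right, hxV, mul_zero]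
  refine ⟨circ x (‖V‖⁻¹ • V) ‖V‖, by simpa [unitSphere] using norm_circ hx hv hxv _,
    (norm_sub_circ_le hx hv hxv _).trans_eq (abs_norm V), fun P hP => ?_⟩
  have := abs_pEval_circ_sub_sub_le hn M hP hx hv hxv (θ := ‖V‖) (by rwa [abs_norm])
  rw [Finset.mul_sum] at this
  convert this using 4
  rw [PiLp.smul_apply, smul_eq_mul, ← mul_assoc, mul_inv_cancel_left₀ hV1]

lemma exists_circ_eq {x y : EuclideanSpace ℝ (Fin d)} (hx : ‖x‖ = 1) (hy : ‖y‖ = 1)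
    (hxy : x ≠ y) (h : ‖x - y‖ < 2) : ∃ v : EuclideanSpace ℝ (Fin d), ∃ θ : ℝ,
      ‖v‖ = 1 ∧ ⟪x, v⟫_ℝ = 0 ∧ y = circ x v θ ∧ |θ| ≤ 2 * ‖x - y‖ := by
  have h1 : ‖x - y‖ ^ 2 = 2 - 2 * ⟪x, y⟫_ℝ := by
    rw [norm_sub_sq_real, hx, hy]
    ring
  have h2 : 0 < ‖x - y‖ := norm_pos_iff.2 (sub_ne_zero.2 hxy)
  set c := ⟪x, y⟫_ℝ with hc
  have hc1 : c < 1 := by nlinarith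
  have hc2 : -1 < c := by nlinarith
  set θ := Real.arccos c with hθ
  have hcos : Real.cos θ = c := Real.cos_arccos hc2.le hc1.le
  have hsin : Real.sin θ = Real.sqrt (1 - c ^ 2) := Real.sin_arccos c
  have hs2 : 0 < 1 - c ^ 2 := by nlinarith
  have hs : 0 < Real.sin θ := by rw [hsin]; exact Real.sqrt_pos.2 hs2
  have hsq : Real.sin θ ^ 2 = 1 - c ^ 2 := by rw [hsin, Real.sq_sqrt hs2.le]
  have hx' : ⟪x, x⟫_ℝ = 1 := by rw [real_inner_self_eq_norm_sq, hx]; norm_num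
  have hn : ‖y - c • x‖ ^ 2 = 1 - c ^ 2 := by
    rw [norm_sub_sq_real, inner_smul_right, real_inner_comm, ← hc, norm_smul, hx, hy,
      Real.norm_eq_abs, mul_one, sq_abs]
    ring
  have hn' : ‖y - c • x‖ = Real.sin θ := by
    have := (sq_eq_sq₀ (norm_nonneg _) hs.le).1 (hn.trans hsq.symm)
    exact this
  refine ⟨(Real.sin θ)⁻¹ • (y - c • x), θ, ?_, ?_, ?_, ?_⟩
  · rw [norm_smul, hn', norm_inv, Real.norm_eq_abs, abs_of_pos hs, inv_mul_cancel₀ hs.ne']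
  · rw [inner_smul_right, inner_sub_right, inner_smul_right, hx', ← hc]
    ring
  · rw [circ, hcos, smul_smul, mul_inv_cancel₀ hs.ne', one_smul]
    abel
  · have hθ0 : 0 ≤ θ := Real.arccos_nonneg c
    rw [abs_of_nonneg hθ0]
    have hq := Real.cos_le_one_sub_mul_cos_sq (x := θ)
      (by rw [abs_of_nonneg hθ0]; exact Real.arccos_le_pi c)
    rw [hcos] at hq
    refine abs_le_of_sq_le_sq' ?_ (by positivity) |>.2
    have h5 : 2 / π ^ 2 * θ ^ 2 ≤ ‖x - y‖ ^ 2 / 2 := by linarith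
    have h6 : π ^ 2 ≤ 16 := by nlinarith [Real.pi_pos, Real.pi_le_four]
    have h7 : θ ^ 2 = π ^ 2 / 2 * (2 / π ^ 2 * θ ^ 2) := by
      field_simp
    rw [h7]
    calc π ^ 2 / 2 * (2 / π ^ 2 * θ ^ 2) ≤ 16 / 2 * (‖x - y‖ ^ 2 / 2) := by gcongr
      _ = (2 * ‖x - y‖) ^ 2 := by ring

lemma norm_eq_one_of_mem {x : EuclideanSpace ℝ (Fin d)} (hx : x ∈ unitSphere d) : ‖x‖ = 1 := by
  simpa [unitSphere] using hx

lemma exists_circ_of_mem {n : ℕ} (hn : 0 < n) {x y : EuclideanSpace ℝ (Fin d)}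
    (hx : x ∈ unitSphere d) (hy : y ∈ unitSphere d) (hxy : x ≠ y) (h : ‖x - y‖ ≤ 1 / n) :
    ∃ v : EuclideanSpace ℝ (Fin d), ∃ θ : ℝ, ‖v‖ = 1 ∧ ⟪x, v⟫_ℝ = 0 ∧ y = circ x v θ ∧
      |θ| ≤ 2 * ‖x - y‖ ∧ |θ| ≤ 2 / n := by
  have hn' : (1 : ℝ) ≤ n := by exact_mod_cast hn
  have h1 : 1 / (n : ℝ) ≤ 1 := by
    rw [div_le_one (by positivity)]
    exact hn'
  obtain ⟨v, θ, h1, h2, h3, h4⟩ := exists_circ_eq (norm_eq_one_of_mem hx) (norm_eq_one_of_mem hy)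
    hxy (by linarith)
  refine ⟨v, θ, h1, h2, h3, h4, h4.trans ?_⟩
  calc 2 * ‖x - y‖ ≤ 2 * (1 / n) := by gcongr
    _ = 2 / n := by ring

lemma abs_pEval_sub_le {n : ℕ} (hn : 0 < n) (M : ℕ) (P : MvPolynomial (Fin d) ℝ)
    {x y : EuclideanSpace ℝ (Fin d)} (hx : x ∈ unitSphere d) (hy : y ∈ unitSphere d)
    (h : ‖x - y‖ ≤ 1 / n) :
    |pEval P y - pEval P x| ≤ 2 * 3 ^ M * gradMax M n P x * ‖x - y‖ := by
  by_cases hxy : x = y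
  · simp [hxy]
  obtain ⟨v, θ, hv, hxv, h3, h4, h5⟩ := exists_circ_of_mem hn hx hy hxy h
  have := gradMax_nonneg M n P x
  calc _ ≤ 3 ^ M * gradMax M n P x * |θ| := by
        nth_rewrite 1 [h3]
        exact abs_pEval_circ_sub_le_gradMax hn M P (norm_eq_one_of_mem hx) hv hxv h5
    _ ≤ 3 ^ M * gradMax M n P x * (2 * ‖x - y‖) := by gcongr
    _ = _ := by ring

lemma abs_gradSize_sub_le {n : ℕ} (hn : 0 < n) (M : ℕ) {P : MvPolynomial (Fin d) ℝ}
    (hP : P.totalDegree ≤ n) {x y : EuclideanSpace ℝ (Fin d)} (hx : x ∈ unitSphere d)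
    (hy : y ∈ unitSphere d) (h : ‖x - y‖ ≤ 1 / n) :
    |gradSize P y - gradSize P x| ≤ 2 * d ^ 2 * oscConst M * n * gradMax M n P x * ‖x - y‖ := by
  by_cases hxy : x = y
  · simp [hxy]
  obtain ⟨v, θ, hv, hxv, h3, h4, h5⟩ := exists_circ_of_mem hn hx hy hxy h
  have := gradMax_nonneg M n P x
  have := oscConst_pos M
  calc _ ≤ d ^ 2 * oscConst M * n * gradMax M n P x * |θ| := by
        nth_rewrite 1 [h3]
        exact abs_gradSize_circ_sub_le hn M hP (norm_eq_one_of_mem hx) hv hxv h5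
    _ ≤ d ^ 2 * oscConst M * n * gradMax M n P x * (2 * ‖x - y‖) := by gcongr
    _ = _ := by ring

/-- The points `z i`, `i ∈ A`, are distributed on the sphere like the measure whose mass on balls of
radius `1 / n` is `V`. -/
structure NodeDensity {ι : Type*} (n s : ℕ) (δ c C : ℝ) (V : EuclideanSpace ℝ (Fin d) → ℝ)
    (A : Finset ι) (z : ι → EuclideanSpace ℝ (Fin d)) : Prop where
  mem : ∀ i, z i ∈ unitSphere d
  pos : ∀ x ∈ unitSphere d, 0 < V x
  compare : ∀ x ∈ unitSphere d, ∀ y ∈ unitSphere d, ‖x - y‖ ≤ 1 / n → V x ≤ C * V y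
  upper : ∀ x ∈ unitSphere d, ∀ j : ℕ,
    (((A.filter fun i => ‖z i - x‖ ≤ 2 ^ j / n).card : ℕ) : ℝ) ≤ C * (2 ^ s) ^ j * V x
  lower : ∀ y ∈ unitSphere d,
    c * V y ≤ (((A.filter fun i => ‖z i - y‖ ≤ δ / n).card : ℕ) : ℝ)

lemma norm_sub_le_two {x y : EuclideanSpace ℝ (Fin d)} (hx : x ∈ unitSphere d)
    (hy : y ∈ unitSphere d) : ‖x - y‖ ≤ 2 := by
  have := norm_sub_le x y
  rw [norm_eq_one_of_mem hx, norm_eq_one_of_mem hy] at this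
  linarith

section NodeDensity

variable {ι : Type*} {n s : ℕ} {δ c C : ℝ} {V : EuclideanSpace ℝ (Fin d) → ℝ}
  {A : Finset ι} {z : ι → EuclideanSpace ℝ (Fin d)}

lemma NodeDensity.sum_decay_le (h : NodeDensity n s δ c C V A z) (hn : 0 < n) (hC : 0 < C)
    {x : EuclideanSpace ℝ (Fin d)} (hx : x ∈ unitSphere d) :
    ∑ k ∈ A, ((1 + n * ‖z k - x‖) ^ (s + 1))⁻¹ ≤ 2 ^ (s + 1) * C * V x := by
  have hn' : (0 : ℝ) < n := by exact_mod_cast hn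
  have hVx := h.pos x hx
  have h1 : ∀ k ∈ A, ((1 + n * ‖z k - x‖) ^ (s + 1))⁻¹
      ≤ ∑ j ∈ Finset.range (2 * n + 1),
        if ‖z k - x‖ ≤ 2 ^ (j + 1) / n then (((2 : ℝ) ^ j) ^ (s + 1))⁻¹ else 0 := by
    intro k _
    have h2 : 1 ≤ 1 + n * ‖z k - x‖ := by
      have : 0 ≤ n * ‖z k - x‖ := by positivity
      linarith
    obtain ⟨j, hj1, hj2⟩ := exists_nat_pow_near h2 (one_lt_two)
    have hj : j ∈ Finset.range (2 * n + 1) := by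
      rw [Finset.mem_range]
      by_contra! hcon
      have h3 : (2 : ℝ) ^ (2 * n + 1) ≤ 2 ^ j := pow_le_pow_right₀ one_le_two hcon
      have h4 : ((2 * n + 1 : ℕ) : ℝ) < 2 ^ (2 * n + 1) := by
        exact_mod_cast Nat.lt_two_pow_self
      have h5 : n * ‖z k - x‖ ≤ n * 2 := by
        gcongr
        exact norm_sub_le_two (h.mem k) hx
      push_cast at h4
      linarith
    refine le_trans ?_ (Finset.single_le_sum (f := fun j => if ‖z k - x‖ ≤ 2 ^ (j + 1) / n then
      (((2 : ℝ) ^ j) ^ (s + 1))⁻¹ else 0) (fun i _ => by split_ifs <;> positivity) hj)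
    have h6 : ‖z k - x‖ ≤ 2 ^ (j + 1) / n := by
      rw [le_div_iff₀ hn', mul_comm]
      linarith
    simp only [h6, if_true]
    gcongr
  calc ∑ k ∈ A, ((1 + n * ‖z k - x‖) ^ (s + 1))⁻¹
      ≤ ∑ k ∈ A, ∑ j ∈ Finset.range (2 * n + 1),
        (if ‖z k - x‖ ≤ 2 ^ (j + 1) / n then (((2 : ℝ) ^ j) ^ (s + 1))⁻¹ else 0) :=
        Finset.sum_le_sum h1
    _ = ∑ j ∈ Finset.range (2 * n + 1),
        (((A.filter fun i => ‖z i - x‖ ≤ 2 ^ (j + 1) / n).card : ℕ) : ℝ)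
          * (((2 : ℝ) ^ j) ^ (s + 1))⁻¹ := by
        rw [Finset.sum_comm]
        refine Finset.sum_congr rfl fun j _ => ?_
        rw [← Finset.sum_filter, Finset.sum_const, nsmul_eq_mul]
    _ ≤ ∑ j ∈ Finset.range (2 * n + 1),
        (C * (2 ^ s) ^ (j + 1) * V x) * (((2 : ℝ) ^ j) ^ (s + 1))⁻¹ := by
        refine Finset.sum_le_sum fun j _ => ?_
        gcongr
        exact h.upper x hx (j + 1)
    _ = (2 ^ s * C * V x) * ∑ j ∈ Finset.range (2 * n + 1), ((1 : ℝ) / 2) ^ j := by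
        rw [Finset.mul_sum]
        refine Finset.sum_congr rfl fun j _ => ?_
        rw [one_div, inv_pow]
        field_simp
        ring
    _ ≤ (2 ^ s * C * V x) * 2 := by
        gcongr
        exact sum_geometric_two_le _
    _ = _ := by ring

/-- The pointwise domination of the maximal function by the values at the nodes. -/
lemma NodeDensity.gradMax_le_sum (h : NodeDensity n s δ c C V A z) (hn : 0 < n) (hC : 0 < C)
    (hc : 0 < c) (hδ1 : δ ≤ 1) (hδ : 2 * d ^ 2 * oscConst (s + 1) * δ ≤ 1 / 2)
    {P : MvPolynomial (Fin d) ℝ} (hP : P.totalDegree ≤ n)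
    {x : EuclideanSpace ℝ (Fin d)} (hx : x ∈ unitSphere d) :
    gradMax (s + 1) n P x ≤ ∑ i ∈ A, 2 ^ (s + 2) * C / c * (gradSize P (z i) / V (z i))
      * ((1 + n * ‖x - z i‖) ^ (s + 1))⁻¹ := by
  have hn' : (0 : ℝ) < n := by exact_mod_cast hn
  obtain ⟨y, hy, hxy⟩ := exists_gradMax_eq (s + 1) n P hx
  have hr := one_add_mul_norm_pos n x y
  set r := 1 + n * ‖x - y‖ with hrdef
  set H := gradMax (s + 1) n P x with hH
  have hH0 : 0 ≤ H := gradMax_nonneg _ _ _ _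
  have hGy : gradSize P y = r ^ (s + 1) * H := by
    rw [hxy]
    field_simp
  have hHy : gradMax (s + 1) n P y ≤ gradSize P y := by
    rw [hGy, hrdef, norm_sub_rev]
    exact gradMax_le (s + 1) n P hy x
  have hVy := h.pos y hy
  set T := A.filter fun i => ‖z i - y‖ ≤ δ / n with hT
  have hGV : ∀ i ∈ A, 0 ≤ gradSize P (z i) / V (z i) := fun i _ =>
    div_nonneg (gradSize_nonneg _ _) (h.pos _ (h.mem i)).le
  have key : ∀ i ∈ T, H / (c * V y) ≤ 2 ^ (s + 2) * C / c * (gradSize P (z i) / V (z i))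
      * ((1 + n * ‖x - z i‖) ^ (s + 1))⁻¹ := by
    intro i hi
    have hi' : ‖y - z i‖ ≤ δ / n := by
      rw [norm_sub_rev]
      exact (Finset.mem_filter.1 hi).2
    have hi1 : ‖y - z i‖ ≤ 1 / n := hi'.trans (by gcongr)
    have hVi := h.pos _ (h.mem i)
    have h1 := abs_gradSize_sub_le hn (s + 1) hP hy (h.mem i) hi1
    have hosc := oscConst_pos (s + 1)
    have h2 : 2 * d ^ 2 * oscConst (s + 1) * n * gradMax (s + 1) n P y * ‖y - z i‖
        ≤ 1 / 2 * gradSize P y := by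
      calc _ ≤ 2 * d ^ 2 * oscConst (s + 1) * n * gradSize P y * (δ / n) := by
            have := gradSize_nonneg P y
            gcongr
        _ = 2 * d ^ 2 * oscConst (s + 1) * δ * gradSize P y := by
            field_simp
        _ ≤ _ := by
            have := gradSize_nonneg P y
            gcongr
    have h3 : gradSize P y ≤ 2 * gradSize P (z i) := by
      have := (abs_le.1 (h1.trans h2)).1
      linarith
    have h4 : 1 + n * ‖x - z i‖ ≤ r * 2 := by
      refine (one_add_mul_norm_le_mul n x y (z i)).trans ?_
      gcongr
      have : (n : ℝ) * ‖y - z i‖ ≤ n * (1 / n) := by gcongr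
      rw [mul_one_div_cancel hn'.ne'] at this
      linarith
    have h5 := h.compare (z i) (h.mem i) y hy (by rwa [norm_sub_rev])
    have h6 := one_add_mul_norm_pos n x (z i)
    rw [hGy] at h3
    rw [div_le_iff₀ (by positivity), ← div_eq_mul_inv, div_mul_eq_mul_div, le_div_iff₀ (by positivity)]
    have h7 := gradSize_nonneg P (z i)
    calc H * (1 + n * ‖x - z i‖) ^ (s + 1) ≤ H * (r * 2) ^ (s + 1) := by gcongr
      _ = 2 ^ (s + 1) * (r ^ (s + 1) * H) := by rw [mul_pow]; ring
      _ ≤ 2 ^ (s + 1) * (2 * gradSize P (z i)) := by gcongr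
      _ = 2 ^ (s + 2) * gradSize P (z i) / V (z i) * V (z i) := by
          field_simp
          ring
      _ ≤ 2 ^ (s + 2) * gradSize P (z i) / V (z i) * (C * V y) := by gcongr
      _ = _ := by
          field_simp
  have hcard := h.lower y hy
  calc H = (c * V y) * (H / (c * V y)) := by field_simp
    _ ≤ (T.card : ℝ) * (H / (c * V y)) := by gcongr
    _ = ∑ i ∈ T, H / (c * V y) := by rw [Finset.sum_const, nsmul_eq_mul]
    _ ≤ ∑ i ∈ T, 2 ^ (s + 2) * C / c * (gradSize P (z i) / V (z i))
      * ((1 + n * ‖x - z i‖) ^ (s + 1))⁻¹ := Finset.sum_le_sum key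
    _ ≤ _ := by
        refine Finset.sum_le_sum_of_subset_of_nonneg (Finset.filter_subset _ _) fun i hi _ => ?_
        have := hGV i hi
        have := one_add_mul_norm_pos n x (z i)
        positivity

/-- The constant in the Marcinkiewicz–Zygmund type inequality for gradients. -/
def mzConst (s : ℕ) (c C : ℝ) : ℝ := 2 ^ (2 * s + 3) * C ^ 2 / c

lemma NodeDensity.sum_gradMax_le (h : NodeDensity n s δ c C V A z) (hn : 0 < n) (hC : 0 < C)
    (hc : 0 < c) (hδ1 : δ ≤ 1) (hδ : 2 * d ^ 2 * oscConst (s + 1) * δ ≤ 1 / 2)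
    {P : MvPolynomial (Fin d) ℝ} (hP : P.totalDegree ≤ n) :
    ∑ i ∈ A, gradMax (s + 1) n P (z i) ≤ mzConst s c C * ∑ i ∈ A, gradSize P (z i) := by
  calc ∑ k ∈ A, gradMax (s + 1) n P (z k)
      ≤ ∑ k ∈ A, ∑ i ∈ A, 2 ^ (s + 2) * C / c * (gradSize P (z i) / V (z i))
      * ((1 + n * ‖z k - z i‖) ^ (s + 1))⁻¹ :=
        Finset.sum_le_sum fun k _ => h.gradMax_le_sum hn hC hc hδ1 hδ hP (h.mem k)
    _ = ∑ i ∈ A, 2 ^ (s + 2) * C / c * (gradSize P (z i) / V (z i))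
      * ∑ k ∈ A, ((1 + n * ‖z k - z i‖) ^ (s + 1))⁻¹ := by
        rw [Finset.sum_comm]
        simp only [Finset.mul_sum]
    _ ≤ ∑ i ∈ A, 2 ^ (s + 2) * C / c * (gradSize P (z i) / V (z i))
      * (2 ^ (s + 1) * C * V (z i)) := by
        refine Finset.sum_le_sum fun i _ => ?_
        have := h.pos _ (h.mem i)
        have := gradSize_nonneg P (z i)
        gcongr
        exact h.sum_decay_le hn hC (h.mem i)
    _ = _ := by
        rw [Finset.mul_sum]
        refine Finset.sum_congr rfl fun i _ => ?_
        have := h.pos _ (h.mem i)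
        unfold mzConst
        field_simp
        ring

lemma mzConst_pos (s : ℕ) (hC : 0 < C) (hc : 0 < c) : 0 < mzConst s c C := by
  unfold mzConst
  positivity

end NodeDensity

/-- A finite-dimensional Hahn–Banach theorem: a linear form dominated by a weighted sum of absolute
values of linear forms is a combination of these forms with coefficients bounded by the weights. -/
lemma exists_coeff_of_abs_le_sum {W κ : Type*} [AddCommGroup W] [Module ℝ W] [Fintype κ]
    (l : κ → W →ₗ[ℝ] ℝ) (E : W →ₗ[ℝ] ℝ) {ε : κ → ℝ} (hε : ∀ k, 0 ≤ ε k)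
    (h : ∀ P, |E P| ≤ ∑ k, ε k * |l k P|) :
    ∃ a : κ → ℝ, (∀ k, |a k| ≤ ε k) ∧ ∀ P, E P = ∑ k, a k * l k P := by
  classical
  set T : W →ₗ[ℝ] (κ → ℝ) := LinearMap.pi l with hT
  have hE : E ∈ LinearMap.range T.dualMap := by
    rw [LinearMap.range_dualMap_eq_dualAnnihilator_ker, Submodule.mem_dualAnnihilator]
    intro P hP
    have h0 : ∀ k, l k P = 0 := fun k => congrFun (LinearMap.mem_ker.1 hP) k
    have := h P
    simp only [h0, abs_zero, mul_zero, Finset.sum_const_zero] at this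
    exact abs_eq_zero.1 (le_antisymm this (abs_nonneg _))
  obtain ⟨F, hF⟩ := hE
  have hF' : ∀ P, F (T P) = E P := fun P => by rw [← hF]; rfl
  set N : (κ → ℝ) → ℝ := fun u => ∑ k, ε k * |u k| with hN
  obtain ⟨g, hg1, hg2⟩ := exists_extension_of_le_sublinear
    (⟨LinearMap.range T, F.domRestrict _⟩ : (κ → ℝ) →ₗ.[ℝ] ℝ) N
    (fun c hc u => by
      simp only [hN, Pi.smul_apply, smul_eq_mul, abs_mul, abs_of_pos hc, Finset.mul_sum]
      exact Finset.sum_congr rfl fun k _ => by ring)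
    (fun u v => by
      simp only [hN, Pi.add_apply, ← Finset.sum_add_distrib, ← mul_add]
      exact Finset.sum_le_sum fun k _ => mul_le_mul_of_nonneg_left (abs_add_le _ _) (hε k))
    (by
      rintro ⟨_, P, rfl⟩
      refine le_trans (le_of_eq (hF' P)) ((le_abs_self _).trans (h P)))
  have hNs : ∀ k (t : ℝ), N (Pi.single k t) = ε k * |t| := by
    intro k t
    simp only [hN]
    rw [Finset.sum_eq_single k]
    · simp
    · intro j _ hj
      simp [hj]
    · simp
  refine ⟨fun k => g (Pi.single k 1), fun k => abs_le.2 ⟨?_, ?_⟩, fun P => ?_⟩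
  · have h1 := hg2 (Pi.single k (-1))
    have h2 : (Pi.single k (-1) : κ → ℝ) = -Pi.single k 1 := by rw [← Pi.single_neg]
    rw [hNs, h2, map_neg, abs_neg, abs_one, mul_one] at h1
    linarith
  · have h1 := hg2 (Pi.single k 1)
    rwa [hNs, abs_one, mul_one] at h1
  · have h1 := hg1 ⟨T P, LinearMap.mem_range_self T P⟩
    have h2 : g (T P) = E P := h1.trans (hF' P)
    rw [← h2, LinearMap.pi_apply_eq_sum_univ g (T P)]
    refine Finset.sum_congr rfl fun k _ => ?_
    rw [smul_eq_mul, mul_comm]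
    congr 2
    ext j
    simp [Pi.single_apply, eq_comm]

/-- Evaluation of polynomials at a point, as a linear map. -/
def pEvalLin (x : EuclideanSpace ℝ (Fin d)) : MvPolynomial (Fin d) ℝ →ₗ[ℝ] ℝ :=
  (MvPolynomial.aeval fun i => x i).toLinearMap

lemma pEvalLin_apply (x : EuclideanSpace ℝ (Fin d)) (P : MvPolynomial (Fin d) ℝ) :
    pEvalLin x P = pEval P x := by
  simp [pEvalLin, pEval, MvPolynomial.aeval_eq_eval]

/-- Evaluation of angular derivatives at a point, as a linear map. -/
def angLin (j k : Fin d) (x : EuclideanSpace ℝ (Fin d)) : MvPolynomial (Fin d) ℝ →ₗ[ℝ] ℝ :=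
  x j • (pEvalLin x ∘ₗ (MvPolynomial.pderiv k).toLinearMap)
    - x k • (pEvalLin x ∘ₗ (MvPolynomial.pderiv j).toLinearMap)

lemma angLin_apply (j k : Fin d) (x : EuclideanSpace ℝ (Fin d)) (P : MvPolynomial (Fin d) ℝ) :
    angLin j k x P = pEval (angDeriv j k P) x := by
  simp [angLin, pEvalLin_apply, pEval_angDeriv]

/-- The tangent vector at `x` with angular coordinates `a`. -/
def tangentVec (x : EuclideanSpace ℝ (Fin d)) (a : Fin d → Fin d → ℝ) :
    EuclideanSpace ℝ (Fin d) :=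
  ∑ j, ∑ k, a j k • (x j • EuclideanSpace.single k (1 : ℝ) - x k • EuclideanSpace.single j (1 : ℝ))

lemma inner_tangentVec (x g : EuclideanSpace ℝ (Fin d)) (a : Fin d → Fin d → ℝ) :
    ⟪g, tangentVec x a⟫_ℝ = ∑ j, ∑ k, a j k * (x j * g k - x k * g j) := by
  simp [tangentVec, inner_sum, inner_smul_right, inner_sub_right,
    EuclideanSpace.inner_single_right]

lemma inner_self_tangentVec (x : EuclideanSpace ℝ (Fin d)) (a : Fin d → Fin d → ℝ) :
    ⟪x, tangentVec x a⟫_ℝ = 0 := by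
  rw [inner_tangentVec]
  exact Finset.sum_eq_zero fun j _ => Finset.sum_eq_zero fun k _ => by ring

lemma norm_tangentVec_le {x : EuclideanSpace ℝ (Fin d)} (hx : ‖x‖ = 1)
    {a : Fin d → Fin d → ℝ} {ε : ℝ} (ha : ∀ j k, |a j k| ≤ ε) :
    ‖tangentVec x a‖ ≤ 2 * d ^ 2 * ε := by
  have h1 : ∀ j k, ‖a j k • (x j • EuclideanSpace.single k (1 : ℝ)
      - x k • EuclideanSpace.single j (1 : ℝ))‖ ≤ ε * 2 := by
    intro j k
    have hε : 0 ≤ ε := (abs_nonneg _).trans (ha j k)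
    rw [norm_smul, Real.norm_eq_abs]
    refine mul_le_mul (ha j k) ((norm_sub_le _ _).trans ?_) (norm_nonneg _) hε
    have h2 := abs_apply_le_one hx j
    have h3 := abs_apply_le_one hx k
    simp only [norm_smul, Real.norm_eq_abs, PiLp.norm_single, norm_one, mul_one]
    linarith
  refine (norm_sum_le _ _).trans ((Finset.sum_le_sum fun j _ => (norm_sum_le _ _).trans
    (Finset.sum_le_sum fun k _ => h1 j k)).trans_eq ?_)
  simp
  ring

lemma sum_tangentVec_mul (P : MvPolynomial (Fin d) ℝ) (x : EuclideanSpace ℝ (Fin d))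
    (a : Fin d → Fin d → ℝ) :
    ∑ k, tangentVec x a k * pEval (MvPolynomial.pderiv k P) x
      = ∑ j, ∑ k, a j k * pEval (angDeriv j k P) x := by
  have := inner_tangentVec x (WithLp.toLp 2 fun k => pEval (MvPolynomial.pderiv k P) x) a
  rw [PiLp.inner_apply] at this
  simpa [pEval_angDeriv] using this

section Newton

variable {ι : Type*} [Fintype ι] {n s : ℕ} {δ c C : ℝ} {V : EuclideanSpace ℝ (Fin d) → ℝ}
  {A : Finset ι} {z : ι → EuclideanSpace ℝ (Fin d)} {I : MvPolynomial (Fin d) ℝ →ₗ[ℝ] ℝ} {ε : ℝ}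

/-- One step of Newton's method for the cubature equations. -/
lemma exists_newton_step (hn : 0 < n) (M : ℕ) (hz : ∀ i, z i ∈ unitSphere d) (hε : 0 ≤ ε)
    (hεn : 2 * d ^ 2 * ε ≤ 2 / n)
    (hE : ∀ P : MvPolynomial (Fin d) ℝ, P.totalDegree ≤ n →
      |∑ i, pEval P (z i) - I P| ≤ ε * ∑ i ∈ A, gradSize P (z i)) :
    ∃ z' : ι → EuclideanSpace ℝ (Fin d), (∀ i, z' i ∈ unitSphere d) ∧
      (∀ i, ‖z i - z' i‖ ≤ 2 * d ^ 2 * ε) ∧ (∀ i ∉ A, z' i = z i) ∧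
      ∀ P : MvPolynomial (Fin d) ℝ, P.totalDegree ≤ n →
        |∑ i, pEval P (z' i) - I P|
          ≤ d ^ 2 * oscConst M * n * (2 * d ^ 2 * ε) ^ 2 * ∑ i ∈ A, gradMax M n P (z i) := by
  classical
  set W := MvPolynomial.restrictTotalDegree (Fin d) ℝ n
  set l : ι × Fin d × Fin d → W →ₗ[ℝ] ℝ := fun q =>
    (angLin q.2.1 q.2.2 (z q.1)).domRestrict W with hl
  set E : W →ₗ[ℝ] ℝ := (I - ∑ i, pEvalLin (z i)).domRestrict W with hEdef
  have hEP : ∀ P : W, E P = I P - ∑ i, pEval (P : MvPolynomial (Fin d) ℝ) (z i) := by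
    intro P
    simp [hEdef, pEvalLin_apply]
  obtain ⟨a, ha1, ha2⟩ := exists_coeff_of_abs_le_sum l E
    (ε := fun q => if q.1 ∈ A then ε else 0) (fun q => by split_ifs; exacts [hε, le_rfl])
    (fun P => by
      have h1 := hE P ((MvPolynomial.mem_restrictTotalDegree _ _ _).1 P.2)
      rw [abs_sub_comm, ← hEP] at h1
      refine h1.trans_eq ?_
      rw [Fintype.sum_prod_type]
      simp only [Fintype.sum_prod_type, hl, LinearMap.domRestrict_apply, angLin_apply, ite_mul,
        zero_mul]
      rw [Finset.mul_sum, ← Finset.sum_filter_add_sum_filter_not Finset.univ (fun i => i ∈ A)]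
      have h2 : ∀ i ∈ Finset.univ.filter (fun i => ¬ i ∈ A), ∑ x, ∑ x_1,
          (if i ∈ A then ε * |pEval (angDeriv x x_1 (P : MvPolynomial (Fin d) ℝ)) (z i)| else 0)
            = 0 := by
        intro i hi
        simp [(Finset.mem_filter.1 hi).2]
      rw [Finset.sum_eq_zero h2, add_zero, Finset.filter_mem_eq_inter, Finset.univ_inter]
      refine Finset.sum_congr rfl fun i hi => ?_
      simp [hi, gradSize, Finset.mul_sum])
  set b : ι → Fin d → Fin d → ℝ := fun i j k => a (i, j, k) with hb
  set U : ι → EuclideanSpace ℝ (Fin d) := fun i => tangentVec (z i) (b i) with hU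
  have hUn : ∀ i, ‖U i‖ ≤ 2 * d ^ 2 * (if i ∈ A then ε else 0) := fun i =>
    norm_tangentVec_le (norm_eq_one_of_mem (hz i)) fun j k => ha1 (i, j, k)
  have hUn' : ∀ i, ‖U i‖ ≤ 2 * d ^ 2 * ε := fun i => (hUn i).trans (by
    split_ifs
    · exact le_rfl
    · rw [mul_zero]
      positivity)
  choose z' hz'1 hz'2 hz'3 using fun i => exists_move hn M (norm_eq_one_of_mem (hz i))
    (inner_self_tangentVec (z i) (b i)) ((hUn' i).trans hεn)
  refine ⟨z', hz'1, fun i => (hz'2 i).trans (hUn' i), fun i hi => ?_, fun P hP => ?_⟩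
  · have := (hz'2 i).trans (hUn i)
    simp only [hi, if_false, mul_zero] at this
    exact (sub_eq_zero.1 (norm_eq_zero.1 (le_antisymm this (norm_nonneg _)))).symm
  · have h1 : I P - ∑ i, pEval P (z i)
        = ∑ i, ∑ k, U i k * pEval (MvPolynomial.pderiv k P) (z i) := by
      have := ha2 ⟨P, (MvPolynomial.mem_restrictTotalDegree _ _ _).2 hP⟩
      rw [hEP, Fintype.sum_prod_type] at this
      simp only [Fintype.sum_prod_type, hl, LinearMap.domRestrict_apply, angLin_apply] at this
      rw [this]
      exact Finset.sum_congr rfl fun i _ => (sum_tangentVec_mul P (z i) (b i)).symm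
    have h2 : ∑ i, pEval P (z' i) - I P = ∑ i, (pEval P (z' i) - pEval P (z i)
        - ∑ k, U i k * pEval (MvPolynomial.pderiv k P) (z i)) := by
      rw [Finset.sum_sub_distrib, Finset.sum_sub_distrib, ← h1]
      ring
    have hosc := oscConst_pos M
    have h3 : ∀ i, |pEval P (z' i) - pEval P (z i)
        - ∑ k, U i k * pEval (MvPolynomial.pderiv k P) (z i)|
        ≤ if i ∈ A then d ^ 2 * oscConst M * n * (2 * d ^ 2 * ε) ^ 2 * gradMax M n P (z i)
          else 0 := by
      intro i
      have hg := gradMax_nonneg M n P (z i)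
      refine (hz'3 i P hP).trans ?_
      have h4 : ‖U i‖ ^ 2 ≤ (2 * d ^ 2 * (if i ∈ A then ε else 0)) ^ 2 := by
        gcongr
        exact hUn i
      refine (mul_le_mul_of_nonneg_left h4 (by positivity)).trans (le_of_eq ?_)
      split_ifs <;> ring
    rw [h2]
    refine (Finset.abs_sum_le_sum_abs _ _).trans ((Finset.sum_le_sum fun i _ => h3 i).trans_eq ?_)
    rw [← Finset.sum_filter, Finset.filter_mem_eq_inter, Finset.univ_inter, Finset.mul_sum]

/-- The constant governing the quadratic convergence of Newton's method. -/
def newtonConst (d s : ℕ) (c C : ℝ) : ℝ :=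
  4 * d ^ 6 * oscConst (s + 1) * 2 ^ (s + 1) * mzConst s c C

/-- Nodes that almost solve the cubature equations can be moved slightly to solve them exactly. -/
lemma exists_exact_of_almost (hn : 0 < n) (hC : 0 < C) (hc : 0 < c) (hδ1 : δ ≤ 1)
    (hδ : 2 * d ^ 2 * oscConst (s + 1) * δ ≤ 1 / 2) (hz : ∀ i, z i ∈ unitSphere d) (hε : 0 ≤ ε)
    (hε1 : 2 * d ^ 2 * ε * n ≤ 1) (hε2 : newtonConst d s c C * n * ε ≤ 1 / 2)
    (hdens : ∀ z' : ι → EuclideanSpace ℝ (Fin d), (∀ i, z' i ∈ unitSphere d) →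
      (∀ i, ‖z i - z' i‖ ≤ 4 * d ^ 2 * ε) → NodeDensity n s δ c C V A z')
    (hE : ∀ P : MvPolynomial (Fin d) ℝ, P.totalDegree ≤ n →
      |∑ i, pEval P (z i) - I P| ≤ ε * ∑ i ∈ A, gradSize P (z i)) :
    ∃ z' : ι → EuclideanSpace ℝ (Fin d), (∀ i, z' i ∈ unitSphere d) ∧
      (∀ i, ‖z i - z' i‖ ≤ 4 * d ^ 2 * ε) ∧ (∀ i ∉ A, z' i = z i) ∧
      ∀ P : MvPolynomial (Fin d) ℝ, P.totalDegree ≤ n → ∑ i, pEval P (z' i) = I P := by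
  have hn' : (0 : ℝ) < n := by exact_mod_cast hn
  set T : Set ((ι → EuclideanSpace ℝ (Fin d)) × ℝ) :=
    {q | (∀ i, q.1 i ∈ unitSphere d) ∧ 0 ≤ q.2 ∧ q.2 ≤ ε ∧
      (∀ i, ‖z i - q.1 i‖ ≤ 4 * d ^ 2 * (ε - q.2)) ∧ (∀ i, i ∉ A → q.1 i = z i) ∧
      ∀ P : MvPolynomial (Fin d) ℝ, P.totalDegree ≤ n →
        |∑ i, pEval P (q.1 i) - I P| ≤ q.2 * ∑ i ∈ A, gradSize P (q.1 i)} with hT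
  have hTc : IsCompact T := by
    refine IsCompact.of_isClosed_subset
      ((isCompact_univ_pi fun _ : ι => isCompact_unitSphere (d := d)).prod
        (isCompact_Icc (a := 0) (b := ε))) ?_ ?_
    · have hP := fun P : MvPolynomial (Fin d) ℝ => continuous_pEval P
      have hG := fun P : MvPolynomial (Fin d) ℝ => continuous_gradSize P
      simp only [hT, ofPred_and, ofPred_forall]
      refine IsClosed.inter (isClosed_iInter fun i => ?_) (IsClosed.inter ?_ (IsClosed.inter ?_
        (IsClosed.inter (isClosed_iInter fun i => ?_) (IsClosed.inter
          (isClosed_iInter fun i => isClosed_iInter fun _ => ?_)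
          (isClosed_iInter fun P => isClosed_iInter fun _ => ?_)))))
      · exact Metric.isClosed_sphere.preimage (by fun_prop)
      · exact isClosed_le (by fun_prop) (by fun_prop)
      · exact isClosed_le (by fun_prop) (by fun_prop)
      · exact isClosed_le (by fun_prop) (by fun_prop)
      · exact isClosed_eq (by fun_prop) (by fun_prop)
      · have := hP P
        have := hG P
        exact isClosed_le (by fun_prop) (by fun_prop)
    · rintro ⟨q, η⟩ hq
      exact ⟨fun i _ => hq.1 i, hq.2.1, hq.2.2.1⟩
  have hTn : T.Nonempty := ⟨(z, ε), hz, hε, le_rfl, by simp, fun _ _ => rfl, hE⟩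
  obtain ⟨⟨q, η⟩, hq, hmin⟩ := hTc.exists_isMinOn hTn continuous_snd.continuousOn
  obtain ⟨hq1, hq2, hq3, hq4, hq5, hq6⟩ := id hq
  simp only at hq1 hq2 hq3 hq4 hq5 hq6
  have hη : η = 0 := by
    by_contra hη0
    have hηpos : 0 < η := lt_of_le_of_ne hq2 (Ne.symm hη0)
    have hηn : 2 * d ^ 2 * η * n ≤ 1 := le_trans (by gcongr) hε1
    have hηn' : 2 * d ^ 2 * η ≤ 2 / n := by
      rw [le_div_iff₀ hn']
      linarith
    obtain ⟨z', h1, h2, h3, h4⟩ := exists_newton_step hn (s + 1) hq1 hq2 hηn' hq6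
    have h5 : ∀ i, ‖z i - z' i‖ ≤ 4 * d ^ 2 * (ε - η / 2) := by
      intro i
      have := norm_sub_le_norm_sub_add_norm_sub (z i) (q i) (z' i)
      have := hq4 i
      have := h2 i
      linarith
    have hD := hdens z' h1 fun i => (h5 i).trans (by gcongr; linarith)
    have hmem : (z', η / 2) ∈ T := by
      refine ⟨h1, by positivity, by linarith, h5,
        fun i hi => (h3 i hi).trans (hq5 i hi), fun P hP => (h4 P hP).trans ?_⟩
      have hosc := oscConst_pos (s + 1)
      have hmz := mzConst_pos s hC hc
      have hG : 0 ≤ ∑ i ∈ A, gradSize P (z' i) :=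
        Finset.sum_nonneg fun i _ => gradSize_nonneg _ _
      have h6 : ∑ i ∈ A, gradMax (s + 1) n P (q i)
          ≤ 2 ^ (s + 1) * ∑ i ∈ A, gradMax (s + 1) n P (z' i) := by
        rw [Finset.mul_sum]
        refine Finset.sum_le_sum fun i _ => (gradMax_le (s + 1) n P (hq1 i) (z' i)).trans ?_
        have := gradMax_nonneg (s + 1) n P (z' i)
        gcongr
        have h7 : n * ‖q i - z' i‖ ≤ n * (2 * d ^ 2 * η) := by
          gcongr
          exact h2 i
        linarith
      calc _ ≤ d ^ 2 * oscConst (s + 1) * n * (2 * d ^ 2 * η) ^ 2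
              * (2 ^ (s + 1) * (mzConst s c C * ∑ i ∈ A, gradSize P (z' i))) := by
            gcongr
            exact h6.trans (by gcongr; exact hD.sum_gradMax_le hn hC hc hδ1 hδ hP)
        _ = newtonConst d s c C * n * η * η * ∑ i ∈ A, gradSize P (z' i) := by
            unfold newtonConst
            ring
        _ ≤ newtonConst d s c C * n * ε * η * ∑ i ∈ A, gradSize P (z' i) := by
            have : 0 ≤ newtonConst d s c C := by
              unfold newtonConst
              positivity
            gcongr
        _ ≤ 1 / 2 * η * ∑ i ∈ A, gradSize P (z' i) := by gcongr
        _ = _ := by ring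
    have := hmin hmem
    simp only [mem_ofPred_eq] at this
    linarith
  subst hη
  refine ⟨q, hq1, fun i => by simpa using hq4 i, hq5, fun P hP => ?_⟩
  have := hq6 P hP
  rw [zero_mul] at this
  exact sub_eq_zero.1 (abs_eq_zero.1 (le_antisymm this (abs_nonneg _)))

end Newton

/-- Rounding of masses on a finite connected set of points: moving mass at most one from every point
to a neighbour makes all masses integral. -/
def HasRounding {E : Type*} [PseudoMetricSpace E] (R : ℝ) (T : Finset E) : Prop :=
  ∀ m : E → ℝ, (∀ x ∈ T, 0 ≤ m x) → (∃ k : ℕ, ∑ x ∈ T, m x = k) →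
    ∃ (a : E → ℕ) (r : E → ℝ) (p : E → E),
      (∀ x ∈ T, 0 ≤ r x ∧ r x ≤ 1 ∧ p x ∈ T ∧ dist x (p x) ≤ R) ∧
      ∀ f : E → ℝ, ∑ x ∈ T, a x * f x = ∑ x ∈ T, m x * f x + ∑ x ∈ T, r x * (f (p x) - f x)

lemma hasRounding_singleton {E : Type*} [PseudoMetricSpace E] {R : ℝ} (hR : 0 ≤ R) (x : E) :
    HasRounding R {x} := by
  rintro m _ ⟨k, hk⟩
  refine ⟨fun _ => k, fun _ => 0, id, by simpa using hR, fun f => ?_⟩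
  simp only [Finset.sum_singleton] at hk ⊢
  simp [hk]

lemma HasRounding.insert {E : Type*} [PseudoMetricSpace E] [DecidableEq E] {R : ℝ} {T : Finset E}
    (hT : HasRounding R T) {x y : E} (hx : x ∈ T) (hy : y ∉ T) (hxy : dist y x ≤ R) :
    HasRounding R (insert y T) := by
  rintro m hm ⟨k, hk⟩
  have hmy : 0 ≤ m y := hm y (Finset.mem_insert_self _ _)
  set φ := Int.fract (m y) with hφ
  have hφ0 : 0 ≤ φ := Int.fract_nonneg _
  have hφ1 : φ ≤ 1 := (Int.fract_lt_one _).le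
  have hfloor : ((⌊m y⌋₊ : ℕ) : ℝ) = m y - φ := by
    rw [natCast_floor_eq_intCast_floor hmy, hφ, Int.self_sub_fract]
  set m' : E → ℝ := fun u => m u + if u = x then φ else 0 with hm'
  have hsum : ∀ f : E → ℝ, ∑ u ∈ T, m' u * f u = ∑ u ∈ T, m u * f u + φ * f x := by
    intro f
    simp [hm', add_mul, Finset.sum_add_distrib, hx]
  have hm'0 : ∀ u ∈ T, 0 ≤ m' u := by
    intro u hu
    have := hm u (Finset.mem_insert_of_mem hu)
    simp only [hm']
    split_ifs <;> positivity
  have h_int : ∃ k' : ℕ, ∑ u ∈ T, m' u = k' := by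
    have h1 := hsum fun _ => 1
    simp only [mul_one] at h1
    rw [Finset.sum_insert hy] at hk
    have h2 : ∑ u ∈ T, m' u = k - (⌊m y⌋₊ : ℕ) := by
      rw [h1, hfloor]
      linarith
    have h3 : 0 ≤ ∑ u ∈ T, m' u := Finset.sum_nonneg hm'0
    rw [h2] at h3
    have h4 : ⌊m y⌋₊ ≤ k := by exact_mod_cast sub_nonneg.1 h3
    exact ⟨k - ⌊m y⌋₊, by rw [h2, Nat.cast_sub h4]⟩
  obtain ⟨a, r, p, h1, h2⟩ := hT m' hm'0 h_int
  have hne : ∀ u ∈ T, u ≠ y := fun u hu h => hy (h ▸ hu)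
  refine ⟨fun u => if u = y then ⌊m y⌋₊ else a u, fun u => if u = y then φ else r u,
    fun u => if u = y then x else p u, ?_, fun f => ?_⟩
  · intro u hu
    rcases Finset.mem_insert.1 hu with rfl | hu
    · simp only [if_true]
      exact ⟨hφ0, hφ1, Finset.mem_insert_of_mem hx, hxy⟩
    · obtain ⟨q1, q2, q3, q4⟩ := h1 u hu
      simp only [hne u hu, if_false]
      exact ⟨q1, q2, Finset.mem_insert_of_mem q3, q4⟩
  · have e1 : ∑ u ∈ T, ((if u = y then ⌊m y⌋₊ else a u : ℕ) : ℝ) * f u = ∑ u ∈ T, a u * f u :=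
      Finset.sum_congr rfl fun u hu => by rw [if_neg (hne u hu)]
    have e2 : ∑ u ∈ T, (if u = y then φ else r u) * (f (if u = y then x else p u) - f u)
        = ∑ u ∈ T, r u * (f (p u) - f u) :=
      Finset.sum_congr rfl fun u hu => by rw [if_neg (hne u hu), if_neg (hne u hu)]
    rw [Finset.sum_insert hy, Finset.sum_insert hy, Finset.sum_insert hy, e1, e2, h2, hsum]
    simp only [if_true, hfloor]
    ring

/-- A finite net in a connected set admits local roundings of masses. -/
lemma hasRounding_of_cover {E : Type*} [PseudoMetricSpace E] {S : Set E} (hS : IsPreconnected S)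
    {ρ : ℝ} (hρ : 0 ≤ ρ) {X : Finset E} (hX : X.Nonempty) (hXS : (X : Set E) ⊆ S)
    (hcov : ∀ y ∈ S, ∃ x ∈ X, dist y x ≤ ρ) : HasRounding (2 * ρ) X := by
  classical
  obtain ⟨x₀, hx₀⟩ := hX
  set F := X.powerset.filter fun T => T.Nonempty ∧ HasRounding (2 * ρ) T with hF
  have hFn : F.Nonempty := ⟨{x₀}, by
    simp [hF, hx₀, hasRounding_singleton (R := 2 * ρ) (by positivity)]⟩
  obtain ⟨T, hTF, hmax⟩ := F.exists_max_image Finset.card hFn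
  obtain ⟨hTX, hTn, hT⟩ : T ⊆ X ∧ T.Nonempty ∧ HasRounding (2 * ρ) T := by
    simpa [hF] using hTF
  by_cases hTX' : T = X
  · rwa [← hTX']
  exfalso
  obtain ⟨y₀, hy₀, hy₀T⟩ : ∃ y ∈ X, y ∉ T := by
    by_contra! hcon
    exact hTX' (Finset.Subset.antisymm hTX hcon)
  obtain ⟨t₀, ht₀⟩ := hTn
  have hcl : ∀ Y : Finset E, IsClosed (⋃ x ∈ Y, Metric.closedBall x ρ) := fun Y =>
    Y.finite_toSet.isClosed_biUnion fun _ _ => Metric.isClosed_closedBall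
  have hmem : ∀ (Y : Finset E), ∀ x ∈ Y, x ∈ ⋃ x ∈ Y, Metric.closedBall x ρ := fun Y x hx =>
    mem_iUnion₂.2 ⟨x, hx, Metric.mem_closedBall_self hρ⟩
  obtain ⟨u, _, hu1, hu2⟩ := isPreconnected_closed_iff.1 hS _ _ (hcl T) (hcl (X \ T))
    (fun y hy => by
      obtain ⟨x, hx, hyx⟩ := hcov y hy
      by_cases hxT : x ∈ T
      · exact Or.inl (mem_iUnion₂.2 ⟨x, hxT, hyx⟩)
      · exact Or.inr (mem_iUnion₂.2 ⟨x, Finset.mem_sdiff.2 ⟨hx, hxT⟩, hyx⟩))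
    ⟨t₀, hXS (hTX ht₀), hmem T t₀ ht₀⟩
    ⟨y₀, hXS hy₀, hmem _ y₀ (Finset.mem_sdiff.2 ⟨hy₀, hy₀T⟩)⟩
  obtain ⟨x, hx, hux⟩ := mem_iUnion₂.1 hu1
  obtain ⟨y, hy, huy⟩ := mem_iUnion₂.1 hu2
  rw [Metric.mem_closedBall] at hux huy
  obtain ⟨hyX, hyT⟩ := Finset.mem_sdiff.1 hy
  have hxy : dist y x ≤ 2 * ρ := by
    have := dist_triangle_left y x u
    linarith
  have hins : insert y T ∈ F := by
    simp only [hF, Finset.mem_filter, Finset.mem_powerset]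
    exact ⟨Finset.insert_subset hyX hTX, Finset.insert_nonempty _ _, hT.insert hx hyT hxy⟩
  have := hmax _ hins
  rw [Finset.card_insert_of_notMem hyT] at this
  omega

/-- A measurable choice of a nearest point in a finite set. -/
lemma exists_measurable_nearest {E : Type*} [PseudoMetricSpace E] [MeasurableSpace E]
    [OpensMeasurableSpace E] {X : Finset E} (hX : X.Nonempty) :
    ∃ φ : E → E, Measurable φ ∧ ∀ y, φ y ∈ X ∧ ∀ x ∈ X, dist y (φ y) ≤ dist y x := by
  classical
  induction hX using Finset.Nonempty.cons_induction with
  | singleton a => exact ⟨fun _ => a, measurable_const, by simp⟩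
  | cons a X ha hX ih =>
    obtain ⟨φ, hφ, h⟩ := ih
    have hmeas : MeasurableSet {y | dist y a ≤ dist y (φ y)} := by
      have h1 : {y | dist y a ≤ dist y (φ y)} = ⋂ x ∈ X, {y | dist y a ≤ dist y x} := by
        ext y
        simp only [mem_iInter]
        exact ⟨fun hy x hx => le_trans hy ((h y).2 x hx), fun hy => hy _ (h y).1⟩
      rw [h1]
      exact X.measurableSet_biInter fun x _ =>
        (isClosed_le (by fun_prop) (by fun_prop)).measurableSet
    refine ⟨fun y => if dist y a ≤ dist y (φ y) then a else φ y,
      Measurable.ite hmeas measurable_const hφ, fun y => ?_⟩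
    obtain ⟨h1, h2⟩ := h y
    simp only [Finset.mem_cons]
    split_ifs with hy
    · refine ⟨Or.inl rfl, ?_⟩
      rintro x (rfl | hx)
      · exact le_rfl
      · exact hy.trans (h2 x hx)
    · refine ⟨Or.inr h1, ?_⟩
      rintro x (rfl | hx)
      · exact (not_le.1 hy).le
      · exact h2 x hx

/-- Compact sets contain finite separated nets. -/
lemma exists_finset_separated_net {E : Type*} [PseudoMetricSpace E] {S : Set E} (hS : IsCompact S)
    {ρ : ℝ} (hρ : 0 < ρ) : ∃ X : Finset E, (X : Set E) ⊆ S ∧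
      (∀ x ∈ X, ∀ y ∈ X, x ≠ y → ρ < dist x y) ∧ ∀ y ∈ S, ∃ x ∈ X, dist y x ≤ ρ := by
  classical
  obtain ⟨t, htS, htf, htc⟩ := hS.finite_cover_balls (half_pos hρ)
  have hbound : ∀ X : Finset E, (X : Set E) ⊆ S → (∀ x ∈ X, ∀ y ∈ X, x ≠ y → ρ < dist x y) →
      X.card ≤ htf.toFinset.card := by
    intro X hXS hX
    have hch : ∀ x ∈ X, ∃ y ∈ htf.toFinset, dist x y < ρ / 2 := by
      intro x hx
      obtain ⟨y, hy, hxy⟩ := mem_iUnion₂.1 (htc (hXS hx))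
      exact ⟨y, by simpa using hy, hxy⟩
    choose! g hg1 hg2 using hch
    refine Finset.card_le_card_of_injOn g hg1 fun x hx y hy hxy => ?_
    by_contra hne
    have h1 := hX x hx y hy hne
    have h2 := hg2 x hx
    have h3 := hg2 y hy
    rw [← hxy] at h3
    have := dist_triangle_right x y (g x)
    linarith
  have hex : ∃ k, ∃ X : Finset E, X.card = k ∧ (X : Set E) ⊆ S ∧
      ∀ x ∈ X, ∀ y ∈ X, x ≠ y → ρ < dist x y := ⟨0, ∅, by simp⟩
  obtain ⟨k, ⟨X, hXk, hXS, hX⟩, hmax⟩ : ∃ k, (∃ X : Finset E, X.card = k ∧ (X : Set E) ⊆ S ∧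
      ∀ x ∈ X, ∀ y ∈ X, x ≠ y → ρ < dist x y) ∧ ¬ ∃ X : Finset E, X.card = k + 1 ∧
        (X : Set E) ⊆ S ∧ ∀ x ∈ X, ∀ y ∈ X, x ≠ y → ρ < dist x y := by
    by_contra! hcon
    have hall : ∀ k, ∃ X : Finset E, X.card = k ∧ (X : Set E) ⊆ S ∧
        ∀ x ∈ X, ∀ y ∈ X, x ≠ y → ρ < dist x y := by
      intro k
      induction k with
      | zero => exact ⟨∅, by simp⟩
      | succ k ih => exact hcon k ih
    obtain ⟨X, h1, h2, h3⟩ := hall (htf.toFinset.card + 1)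
    have := hbound X h2 h3
    omega
  refine ⟨X, hXS, hX, fun y hy => ?_⟩
  by_contra! hcon
  refine hmax ⟨insert y X, ?_, ?_, ?_⟩
  · rw [Finset.card_insert_of_notMem, hXk]
    intro hyX
    have := hcon y hyX
    rw [dist_self] at this
    linarith
  · rw [Finset.coe_insert]
    exact insert_subset hy hXS
  · intro x hx x' hx' hne
    rcases Finset.mem_insert.1 hx with rfl | h1 <;> rcases Finset.mem_insert.1 hx' with rfl | h2
    · exact absurd rfl hne
    · exact hcon _ h2
    · rw [dist_comm]
      exact hcon _ h1
    · exact hX x h1 x' h2 hne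

/-- A family of points in which every `x ∈ X` is repeated `a x` times. -/
lemma exists_family_with_multiplicities {E : Type*} (X : Finset E) (a : E → ℕ) {k : ℕ}
    (hk : ∑ x ∈ X, a x = k) : ∃ z : Fin k → E, (∀ i, z i ∈ X) ∧
      ∀ g : E → ℝ, ∑ i, g (z i) = ∑ x ∈ X, a x * g x := by
  have hcard : Fintype.card ((x : X) × Fin (a x)) = k := by
    rw [Fintype.card_sigma, ← hk, ← Finset.sum_coe_sort X a]
    simp
  set e := Fintype.equivFinOfCardEq hcard
  refine ⟨fun i => ((e.symm i).1 : E), fun i => (e.symm i).1.2, fun g => ?_⟩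
  rw [e.symm.sum_comp (fun q => g (q.1 : E)), Fintype.sum_sigma,
    ← Finset.sum_coe_sort X fun x => a x * g x]
  simp

lemma integrable_comp_and_integral_comp {E : Type*} [MeasurableSpace E]
    [MeasurableSingletonClass E] {ν : Measure E} [IsFiniteMeasure ν] {X : Finset E} {φ : E → E}
    (hφ : Measurable φ) (hφX : ∀ y, φ y ∈ X) (g : E → ℝ) :
    Integrable (fun y => g (φ y)) ν ∧
      ∫ y, g (φ y) ∂ν = ∑ x ∈ X, ν.real (φ ⁻¹' {x}) * g x := by
  classical
  have h1 : (fun y => g (φ y)) = fun y => ∑ x ∈ X, (φ ⁻¹' {x}).indicator (fun _ => g x) y := by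
    funext y
    rw [Finset.sum_eq_single (φ y)]
    · simp
    · intro x _ hx
      rw [indicator_of_notMem]
      simpa using hx.symm
    · exact fun h => absurd (hφX y) h
  have hm : ∀ x, MeasurableSet (φ ⁻¹' {x}) := fun x => hφ (measurableSet_singleton x)
  have h_int : ∀ x ∈ X, Integrable ((φ ⁻¹' {x}).indicator fun _ => g x) ν := fun x _ =>
    (integrable_const (g x)).indicator (hm x)
  rw [h1]
  refine ⟨integrable_finsetSum X h_int, ?_⟩
  rw [integral_finsetSum X h_int]
  refine Finset.sum_congr rfl fun x _ => ?_
  rw [integral_indicator_const _ (hm x), smul_eq_mul]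

lemma isPreconnected_unitSphere (hd : 2 ≤ d) : IsPreconnected (unitSphere d) := by
  refine isPreconnected_sphere ?_ _ _
  rw [← Module.finrank_eq_rank, finrank_euclideanSpace_fin]
  exact_mod_cast hd

lemma integrable_pEval {ν : Measure (EuclideanSpace ℝ (Fin d))} [IsFiniteMeasure ν]
    (hνS : ∀ᵐ y ∂ν, y ∈ unitSphere d) (P : MvPolynomial (Fin d) ℝ) : Integrable (pEval P) ν := by
  obtain ⟨B, hB⟩ := (isCompact_unitSphere (d := d)).exists_bound_of_continuousOn
    (continuous_pEval P).continuousOn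
  refine Integrable.of_bound (continuous_pEval P).aestronglyMeasurable B ?_
  filter_upwards [hνS] with y hy using hB y hy

lemma card_filter_norm_sub_le {ι : Type*} (A : Finset ι) (z : ι → EuclideanSpace ℝ (Fin d))
    (x : EuclideanSpace ℝ (Fin d)) (r : ℝ) :
    (((A.filter fun i => ‖z i - x‖ ≤ r).card : ℕ) : ℝ)
      = ∑ i ∈ A, (fun u => if ‖u - x‖ ≤ r then (1 : ℝ) else 0) (z i) := by
  rw [Finset.card_filter]
  push_cast
  rfl

/-- Initial nodes distributed like `ν`, almost solving the cubature equations. -/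
lemma exists_initial_nodes (hd : 2 ≤ d) {n k : ℕ} (hn : 0 < n) {ρ : ℝ} (hρ : 0 < ρ)
    (hρn : 2 * ρ ≤ 1 / n) {ν : Measure (EuclideanSpace ℝ (Fin d))} [IsProbabilityMeasure ν]
    (hνS : ∀ᵐ y ∂ν, y ∈ unitSphere d)
    (hmass : ∀ x ∈ unitSphere d, 2 ≤ k * ν.real (Metric.ball x (ρ / 2))) :
    ∃ z : Fin k → EuclideanSpace ℝ (Fin d), (∀ i, z i ∈ unitSphere d) ∧
      (∀ x r, (((Finset.univ.filter fun i => ‖z i - x‖ ≤ r).card : ℕ) : ℝ)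
        ≤ 2 * (k * ν.real (Metric.closedBall x (r + 3 * ρ)))) ∧
      (∀ x r, 1 / 2 * (k * ν.real (Metric.closedBall x (r - ρ)))
        ≤ (((Finset.univ.filter fun i => ‖z i - x‖ ≤ r).card : ℕ) : ℝ)) ∧
      ∀ (M : ℕ) (P : MvPolynomial (Fin d) ℝ),
        |∑ i, pEval P (z i) - k * ∫ y, pEval P y ∂ν|
          ≤ 12 * 3 ^ M * ρ * ∑ i, gradMax M n P (z i) := by
  classical
  obtain ⟨X, hXS, hsep, hcov⟩ := exists_finset_separated_net (isCompact_unitSphere (d := d)) hρ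
  obtain ⟨y₀, hy₀⟩ : (unitSphere d).Nonempty := by
    obtain ⟨y, hy⟩ := hνS.exists
    exact ⟨y, hy⟩
  have hXn : X.Nonempty := by
    obtain ⟨x, hx, _⟩ := hcov y₀ hy₀
    exact ⟨x, hx⟩
  obtain ⟨φ, hφm, hφ⟩ := exists_measurable_nearest hXn
  have hφS : ∀ y ∈ unitSphere d, ‖φ y - y‖ ≤ ρ := by
    intro y hy
    obtain ⟨x, hx, hyx⟩ := hcov y hy
    rw [← dist_eq_norm, dist_comm]
    exact ((hφ y).2 x hx).trans hyx
  set m : EuclideanSpace ℝ (Fin d) → ℝ := fun x => k * ν.real (φ ⁻¹' {x}) with hm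
  have hcomp := fun g => integrable_comp_and_integral_comp (ν := ν) hφm (fun y => (hφ y).1) g
  have hmg : ∀ g : EuclideanSpace ℝ (Fin d) → ℝ,
      ∑ x ∈ X, m x * g x = k * ∫ y, g (φ y) ∂ν := by
    intro g
    rw [(hcomp g).2, Finset.mul_sum]
    exact Finset.sum_congr rfl fun x _ => by rw [hm]; ring
  have hm2 : ∀ x ∈ X, 2 ≤ m x := by
    intro x hx
    refine (hmass x (hXS hx)).trans ?_
    simp only [hm]
    have hsub : Metric.ball x (ρ / 2) ⊆ φ ⁻¹' {x} := by
      intro y hy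
      rw [Metric.mem_ball] at hy
      by_contra hne
      have h1 := hsep (φ y) (hφ y).1 x hx hne
      have h2 := (hφ y).2 x hx
      have h3 := dist_triangle_left (φ y) x y
      linarith
    exact mul_le_mul_of_nonneg_left (measureReal_mono hsub) (Nat.cast_nonneg k)
  have hm0 : ∀ x ∈ X, 0 ≤ m x := fun x hx => by linarith [hm2 x hx]
  obtain ⟨a, r, p, hp, ha⟩ := hasRounding_of_cover (isPreconnected_unitSphere hd) hρ.le hXn hXS
    hcov m hm0 ⟨k, by
      have := hmg fun _ => 1
      simpa using this⟩
  have hasum : ∑ x ∈ X, a x = k := by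
    have h1 := ha fun _ => 1
    have h2 := hmg fun _ => 1
    simp only [mul_one, sub_self, mul_zero, Finset.sum_const_zero, add_zero, integral_const,
      probReal_univ, smul_eq_mul] at h1 h2
    rw [h2] at h1
    exact_mod_cast h1
  obtain ⟨z, hzX, hz⟩ := exists_family_with_multiplicities X a hasum
  have hahalf : ∀ x ∈ X, m x / 2 ≤ a x := by
    intro c hc
    have h1 := ha fun u => if u = c then 1 else 0
    simp only [mul_ite, mul_one, mul_zero, Finset.sum_ite_eq', hc, if_true] at h1
    have h2 : -r c ≤ ∑ x ∈ X, r x * ((if p x = c then 1 else 0) - if x = c then 1 else 0) := by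
      have h3 : ∑ x ∈ X, -(if x = c then r x else 0) = - r c := by
        rw [Finset.sum_neg_distrib]
        simp [hc]
      rw [← h3]
      refine Finset.sum_le_sum fun x hx => ?_
      have := (hp x hx).1
      split_ifs <;> simp [this]
    have := (hp c hc).2.1
    have := hm2 c hc
    linarith
  refine ⟨z, fun i => hXS (hzX i), fun x R => ?_, fun x R => ?_, fun M P => ?_⟩
  · rw [card_filter_norm_sub_le, hz (fun u => if ‖u - x‖ ≤ R then (1 : ℝ) else 0), ha]
    set f : EuclideanSpace ℝ (Fin d) → ℝ := fun u => if ‖u - x‖ ≤ R then (1 : ℝ) else 0 with hf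
    set g : EuclideanSpace ℝ (Fin d) → ℝ := fun u => if ‖u - x‖ ≤ R + 2 * ρ then (1 : ℝ) else 0
      with hg
    have h1 : ∀ u ∈ X, m u * f u ≤ m u * g u := by
      intro u hu
      refine mul_le_mul_of_nonneg_left ?_ (hm0 u hu)
      simp only [hf, hg]
      split_ifs <;> linarith
    have h2 : ∀ u ∈ X, r u * (f (p u) - f u) ≤ m u * g u := by
      intro u hu
      obtain ⟨q1, q2, -, q4⟩ := hp u hu
      have hfu : 0 ≤ f u := by simp only [hf]; split_ifs <;> norm_num
      have hfg : f (p u) ≤ g u := by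
        simp only [hf, hg]
        have := norm_sub_le_norm_sub_add_norm_sub u (p u) x
        rw [dist_eq_norm] at q4
        split_ifs <;> linarith
      have hfp : 0 ≤ f (p u) := by simp only [hf]; split_ifs <;> norm_num
      have := hm2 u hu
      calc r u * (f (p u) - f u) ≤ r u * f (p u) := by gcongr; linarith
        _ ≤ m u * g u := mul_le_mul (by linarith) hfg hfp (by linarith)
    have h3 : ∫ y, g (φ y) ∂ν ≤ ν.real (Metric.closedBall x (R + 3 * ρ)) := by
      rw [← integral_indicator_one Metric.isClosed_closedBall.measurableSet]
      refine integral_mono_ae (hcomp g).1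
        ((integrable_const 1).indicator Metric.isClosed_closedBall.measurableSet) ?_
      filter_upwards [hνS] with y hy
      simp only [hg]
      split_ifs with hy'
      · rw [indicator_of_mem]
        · simp
        rw [Metric.mem_closedBall, dist_eq_norm]
        have := norm_sub_le_norm_sub_add_norm_sub y (φ y) x
        have h4 := hφS y hy
        rw [norm_sub_rev] at h4
        linarith
      · exact indicator_nonneg (fun _ _ => zero_le_one) _
    calc _ ≤ ∑ u ∈ X, m u * g u + ∑ u ∈ X, m u * g u :=
          add_le_add (Finset.sum_le_sum h1) (Finset.sum_le_sum h2)
      _ = 2 * (k * ∫ y, g (φ y) ∂ν) := by rw [hmg]; ring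
      _ ≤ _ := by gcongr
  · rw [card_filter_norm_sub_le, hz (fun u => if ‖u - x‖ ≤ R then (1 : ℝ) else 0)]
    set f : EuclideanSpace ℝ (Fin d) → ℝ := fun u => if ‖u - x‖ ≤ R then (1 : ℝ) else 0 with hf
    have h3 : ν.real (Metric.closedBall x (R - ρ)) ≤ ∫ y, f (φ y) ∂ν := by
      rw [← integral_indicator_one Metric.isClosed_closedBall.measurableSet]
      refine integral_mono_ae
        ((integrable_const 1).indicator Metric.isClosed_closedBall.measurableSet) (hcomp f).1 ?_
      filter_upwards [hνS] with y hy
      have hfy : 0 ≤ f (φ y) := by simp only [hf]; split_ifs <;> norm_num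
      by_cases hy' : y ∈ Metric.closedBall x (R - ρ)
      · rw [indicator_of_mem hy']
        rw [Metric.mem_closedBall, dist_eq_norm] at hy'
        have := norm_sub_le_norm_sub_add_norm_sub (φ y) y x
        have h4 := hφS y hy
        have h5 : ‖φ y - x‖ ≤ R := by linarith
        simp [hf, h5]
      · rwa [indicator_of_notMem hy']
    calc _ ≤ 1 / 2 * (k * ∫ y, f (φ y) ∂ν) := by gcongr
      _ = ∑ u ∈ X, m u / 2 * f u := by
          rw [← hmg, Finset.mul_sum]
          exact Finset.sum_congr rfl fun u _ => by ring
      _ ≤ _ := by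
          refine Finset.sum_le_sum fun u hu => mul_le_mul_of_nonneg_right (hahalf u hu) ?_
          simp only [hf]
          split_ifs <;> norm_num
  · have hH := gradMax_nonneg M n P
    have h1 : |∑ x ∈ X, r x * (pEval P (p x) - pEval P x)|
        ≤ ∑ x ∈ X, 4 * 3 ^ M * ρ * (m x * gradMax M n P x) := by
      refine (Finset.abs_sum_le_sum_abs _ _).trans (Finset.sum_le_sum fun x hx => ?_)
      obtain ⟨q1, q2, q3, q4⟩ := hp x hx
      rw [dist_eq_norm] at q4
      have h2 := abs_pEval_sub_le hn M P (hXS hx) (hXS q3) (q4.trans hρn)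
      have h3 := hm2 x hx
      have h4 := hH x
      rw [abs_mul, abs_of_nonneg q1]
      calc _ ≤ m x * (2 * 3 ^ M * gradMax M n P x * (2 * ρ)) := by
            refine mul_le_mul (by linarith) (h2.trans ?_) (abs_nonneg _) (by linarith)
            gcongr
        _ = _ := by ring
    have h5 : |k * ∫ y, pEval P (φ y) ∂ν - k * ∫ y, pEval P y ∂ν|
        ≤ ∑ x ∈ X, 2 * 3 ^ M * ρ * (m x * gradMax M n P x) := by
      rw [← mul_sub, ← integral_sub (hcomp _).1 (integrable_pEval hνS P), abs_mul,
        Nat.abs_cast, ← Finset.mul_sum, hmg]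
      have h6 : |∫ y, (pEval P (φ y) - pEval P y) ∂ν|
          ≤ ∫ y, 2 * 3 ^ M * ρ * gradMax M n P (φ y) ∂ν := by
        refine abs_integral_le_integral_abs.trans ?_
        refine integral_mono_ae ((hcomp _).1.sub (integrable_pEval hνS P)).abs
          ((hcomp (gradMax M n P)).1.const_mul _) ?_
        filter_upwards [hνS] with y hy
        have h7 := abs_pEval_sub_le hn M P (hXS (hφ y).1) hy
          ((hφS y hy).trans (by linarith))
        have h8 := hH (φ y)
        have h9 := hφS y hy
        rw [abs_sub_comm]
        calc _ ≤ 2 * 3 ^ M * gradMax M n P (φ y) * ρ := h7.trans (by gcongr)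
          _ = _ := by ring
      calc _ ≤ k * ∫ y, 2 * 3 ^ M * ρ * gradMax M n P (φ y) ∂ν := by gcongr
        _ = _ := by rw [integral_const_mul]; ring
    have h10 : ∑ i, pEval P (z i) - k * ∫ y, pEval P y ∂ν
        = (k * ∫ y, pEval P (φ y) ∂ν - k * ∫ y, pEval P y ∂ν)
          + ∑ x ∈ X, r x * (pEval P (p x) - pEval P x) := by
      rw [hz (pEval P), ha, hmg]
      ring
    rw [h10]
    refine (abs_add_le _ _).trans ((add_le_add h5 h1).trans ?_)
    rw [hz (gradMax M n P), ← Finset.sum_add_distrib, Finset.mul_sum]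
    refine Finset.sum_le_sum fun x hx => ?_
    have h11 := hahalf x hx
    have h12 := hH x
    calc _ = 12 * 3 ^ M * ρ * (m x / 2 * gradMax M n P x) := by ring
      _ ≤ _ := by gcongr

lemma measureReal_closedBall_le {ν : Measure (EuclideanSpace ℝ (Fin d))} {D : ℝ} (hD : 0 ≤ D)
    (hdbl : ∀ x ∈ unitSphere d, ∀ r : ℝ, 0 < r →
      ν.real (Metric.closedBall x (2 * r)) ≤ D * ν.real (Metric.closedBall x r))
    {x : EuclideanSpace ℝ (Fin d)} (hx : x ∈ unitSphere d) {r : ℝ} (hr : 0 < r) (j : ℕ) :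
    ν.real (Metric.closedBall x (2 ^ j * r)) ≤ D ^ j * ν.real (Metric.closedBall x r) := by
  induction j with
  | zero => simp
  | succ j ih =>
    calc ν.real (Metric.closedBall x (2 ^ (j + 1) * r))
        = ν.real (Metric.closedBall x (2 * (2 ^ j * r))) := by ring_nf
      _ ≤ D * ν.real (Metric.closedBall x (2 ^ j * r)) := hdbl x hx _ (by positivity)
      _ ≤ D * (D ^ j * ν.real (Metric.closedBall x r)) := by gcongr
      _ = _ := by ring

lemma nodeDensity_of_card_bounds {n k s t : ℕ} (hn : 0 < n) {ρ : ℝ} (hρ : ρ ≤ 1 / 2 ^ t / 4 / n)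
    {ν : Measure (EuclideanSpace ℝ (Fin d))} [IsProbabilityMeasure ν]
    (hdbl : ∀ x ∈ unitSphere d, ∀ r : ℝ, 0 < r →
      ν.real (Metric.closedBall x (2 * r)) ≤ 2 ^ s * ν.real (Metric.closedBall x r))
    (hV : ∀ x ∈ unitSphere d,
      8 * (2 ^ s) ^ (t + 1) ≤ k * ν.real (Metric.closedBall x (1 / n)))
    {z z' : Fin k → EuclideanSpace ℝ (Fin d)}
    (hU : ∀ x r, (((Finset.univ.filter fun i => ‖z i - x‖ ≤ r).card : ℕ) : ℝ)
        ≤ 2 * (k * ν.real (Metric.closedBall x (r + 3 * ρ))))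
    (hL : ∀ x r, 1 / 2 * (k * ν.real (Metric.closedBall x (r - ρ)))
        ≤ (((Finset.univ.filter fun i => ‖z i - x‖ ≤ r).card : ℕ) : ℝ))
    (hz' : ∀ i, z' i ∈ unitSphere d) (hzz' : ∀ i, ‖z i - z' i‖ ≤ 1 / 2 ^ t / 4 / n)
    {A : Finset (Fin k)} (hA : Aᶜ.card ≤ 2) :
    NodeDensity n s (1 / 2 ^ t) (1 / 4 / (2 ^ s) ^ (t + 1)) (2 * 2 ^ s)
      (fun x => k * ν.real (Metric.closedBall x (1 / n))) A z' := by
  classical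
  have hn' : (0 : ℝ) < n := by exact_mod_cast hn
  have ht : (1 : ℝ) / 2 ^ t ≤ 1 := by
    rw [div_le_one (by positivity)]
    exact one_le_pow₀ one_le_two
  set δ : ℝ := 1 / 2 ^ t with hδ
  have hδ0 : 0 < δ := by positivity
  refine ⟨hz', fun x hx => lt_of_lt_of_le (by positivity) (hV x hx), fun x hx y hy hxy => ?_,
    fun x hx j => ?_, fun y hy => ?_⟩
  · have h1 : Metric.closedBall x (1 / n) ⊆ Metric.closedBall y (2 * (1 / (n : ℝ))) := by
      refine Metric.closedBall_subset_closedBall' ?_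
      rw [dist_eq_norm]
      linarith
    have h2 := (measureReal_mono (μ := ν) h1).trans (hdbl y hy _ (by positivity))
    have h3 : 0 ≤ ν.real (Metric.closedBall y (1 / n)) := measureReal_nonneg
    calc (k : ℝ) * ν.real (Metric.closedBall x (1 / n))
        ≤ k * (2 ^ s * ν.real (Metric.closedBall y (1 / n))) := by gcongr
      _ = 2 ^ s * (k * ν.real (Metric.closedBall y (1 / n))) := by ring
      _ ≤ 2 * 2 ^ s * (k * ν.real (Metric.closedBall y (1 / n))) := by
          gcongr
          linarith [pow_pos (two_pos (α := ℝ)) s]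
  · have h1 : (A.filter fun i => ‖z' i - x‖ ≤ 2 ^ j / n)
        ⊆ Finset.univ.filter fun i => ‖z i - x‖ ≤ 2 ^ j / n + δ / 4 / n := by
      intro i hi
      rw [Finset.mem_filter] at hi ⊢
      refine ⟨Finset.mem_univ _, ?_⟩
      have := norm_sub_le_norm_sub_add_norm_sub (z i) (z' i) x
      linarith [hzz' i, hi.2]
    have h2 : ν.real (Metric.closedBall x (2 ^ j / n + δ / 4 / n + 3 * ρ))
        ≤ ν.real (Metric.closedBall x (2 ^ (j + 1) * (1 / n))) := by
      refine measureReal_mono (Metric.closedBall_subset_closedBall ?_)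
      have h3 : (1 : ℝ) ≤ 2 ^ j := one_le_pow₀ one_le_two
      have h4 : δ / 4 / n + 3 * ρ ≤ δ / n := by
        have : δ / n = δ / 4 / n + 3 * (δ / 4 / n) := by ring
        linarith
      have h5 : δ / n ≤ 2 ^ j / n := by
        gcongr
        linarith
      have h6 : (2 : ℝ) ^ (j + 1) * (1 / n) = 2 ^ j / n + 2 ^ j / n := by ring
      linarith
    have h7 := measureReal_closedBall_le (by positivity) hdbl hx (one_div_pos.2 hn') (j + 1)
    calc (((A.filter fun i => ‖z' i - x‖ ≤ 2 ^ j / n).card : ℕ) : ℝ)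
        ≤ (((Finset.univ.filter fun i => ‖z i - x‖ ≤ 2 ^ j / n + δ / 4 / n).card : ℕ) : ℝ) := by
          exact_mod_cast Finset.card_le_card h1
      _ ≤ _ := hU x _
      _ ≤ 2 * (k * ((2 ^ s) ^ (j + 1) * ν.real (Metric.closedBall x (1 / n)))) := by
          gcongr
          exact h2.trans h7
      _ = _ := by ring
  · have h1 : (Finset.univ.filter fun i => ‖z i - y‖ ≤ 3 * (δ / 4 / n))
        ⊆ (A.filter fun i => ‖z' i - y‖ ≤ δ / n) ∪ Aᶜ := by
      intro i hi
      rw [Finset.mem_filter] at hi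
      rw [Finset.mem_union, Finset.mem_filter, Finset.mem_compl]
      by_cases hiA : i ∈ A
      · refine Or.inl ⟨hiA, ?_⟩
        have := norm_sub_le_norm_sub_add_norm_sub (z' i) (z i) y
        have h2 := hzz' i
        rw [norm_sub_rev] at h2
        have : δ / n = δ / 4 / n + 3 * (δ / 4 / n) := by ring
        linarith [hi.2]
      · exact Or.inr hiA
    have h2 := (Finset.card_le_card h1).trans (Finset.card_union_le _ _)
    have h3 : ((Finset.univ.filter fun i => ‖z i - y‖ ≤ 3 * (δ / 4 / n)).card : ℝ)
        ≤ ((A.filter fun i => ‖z' i - y‖ ≤ δ / n).card : ℝ) + 2 := by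
      exact_mod_cast h2.trans (by lia)
    have h4 := hL y (3 * (δ / 4 / n))
    have h5 : ν.real (Metric.closedBall y (δ / 2 / n))
        ≤ ν.real (Metric.closedBall y (3 * (δ / 4 / n) - ρ)) := by
      refine measureReal_mono (Metric.closedBall_subset_closedBall ?_)
      have : δ / 2 / n = 3 * (δ / 4 / n) - δ / 4 / n := by ring
      linarith
    have h6 := measureReal_closedBall_le (by positivity) hdbl hy
      (show 0 < δ / 2 / (n : ℝ) by positivity) (t + 1)
    have h7 : (2 : ℝ) ^ (t + 1) * (δ / 2 / n) = 1 / n := by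
      rw [hδ]
      field_simp
      ring
    rw [h7] at h6
    have h8 := hV y hy
    set D : ℝ := (2 ^ s) ^ (t + 1) with hD
    have hD0 : 0 < D := by positivity
    set v := ν.real (Metric.closedBall y (1 / n)) with hv
    have h9 : k * v / D ≤ k * ν.real (Metric.closedBall y (δ / 2 / n)) := by
      rw [div_le_iff₀ hD0]
      calc k * v ≤ k * (D * ν.real (Metric.closedBall y (δ / 2 / n))) := by gcongr
        _ = _ := by ring
    have h10 : k * ν.real (Metric.closedBall y (δ / 2 / n))
        ≤ k * ν.real (Metric.closedBall y (3 * (δ / 4 / n) - ρ)) := by gcongr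
    have h11 : 8 ≤ k * v / D := by
      rw [le_div_iff₀ hD0]
      exact h8
    have h12 : 1 / 4 / D * (k * v) = 1 / 4 * (k * v / D) := by ring
    show 1 / 4 / D * (k * v) ≤ _
    rw [h12]
    linarith

lemma exists_pow_two_mul_le (a b : ℝ) (hb : 0 < b) : ∃ t : ℕ, a * (1 / 2 ^ t) ≤ b := by
  obtain ⟨t, ht⟩ := pow_unbounded_of_one_lt (a / b) (one_lt_two (α := ℝ))
  refine ⟨t, ?_⟩
  rw [mul_one_div, div_le_iff₀ (by positivity)]
  rw [div_lt_iff₀ hb] at ht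
  linarith

/-- Integration against `ν` as a linear functional on polynomials. -/
def pIntegral (ν : Measure (EuclideanSpace ℝ (Fin d))) [IsFiniteMeasure ν]
    (hνS : ∀ᵐ y ∂ν, y ∈ unitSphere d) : MvPolynomial (Fin d) ℝ →ₗ[ℝ] ℝ where
  toFun P := ∫ y, pEval P y ∂ν
  map_add' P Q := by
    rw [← integral_add (integrable_pEval hνS P) (integrable_pEval hνS Q)]
    simp [pEval]
  map_smul' a P := by
    rw [RingHom.id_apply, smul_eq_mul, ← integral_const_mul]
    simp [pEval]

/-- Exact equal-weight nodes for a doubling measure, all of whose small perturbations are well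
distributed. -/
lemma exists_exact_nodes (hd : 2 ≤ d) (s : ℕ) :
    ∃ δ c C K : ℝ, 0 < C ∧ 0 < c ∧ δ ≤ 1 ∧ 2 * d ^ 2 * oscConst (s + 1) * δ ≤ 1 / 2 ∧ 0 < K ∧
      ∀ (ν : Measure (EuclideanSpace ℝ (Fin d))) [IsProbabilityMeasure ν]
        (hνS : ∀ᵐ y ∂ν, y ∈ unitSphere d),
        (∀ x ∈ unitSphere d, ∀ r : ℝ, 0 < r →
          ν.real (Metric.closedBall x (2 * r)) ≤ 2 ^ s * ν.real (Metric.closedBall x r)) →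
        ∀ n k : ℕ, 0 < n →
        (∀ x ∈ unitSphere d, K ≤ k * ν.real (Metric.closedBall x (1 / n))) →
        ∃ (R : ℝ) (z₀ z : Fin k → EuclideanSpace ℝ (Fin d)),
          (∀ i, z i ∈ unitSphere d) ∧ (∀ i, ‖z₀ i - z i‖ < R) ∧
          (∀ P : MvPolynomial (Fin d) ℝ, P.totalDegree ≤ n →
            ∑ i, pEval P (z i) = k * pIntegral ν hνS P) ∧
          ∀ (A : Finset (Fin k)) (z' : Fin k → EuclideanSpace ℝ (Fin d)), Aᶜ.card ≤ 2 →
            (∀ i, z' i ∈ unitSphere d) → (∀ i, ‖z₀ i - z' i‖ < R) →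
            NodeDensity n s δ c C (fun x => k * ν.real (Metric.closedBall x (1 / n))) A z' := by
  obtain ⟨t, ht⟩ := exists_pow_two_mul_le (2 * d ^ 2 * oscConst (s + 1)) (1 / 2) (by norm_num)
  set δ : ℝ := 1 / 2 ^ t with hδ
  set D : ℝ := 2 ^ s with hD
  set c : ℝ := 1 / 4 / D ^ (t + 1) with hc
  set C : ℝ := 2 * D with hC
  have hD0 : 0 < D := by positivity
  have hc0 : 0 < c := by positivity
  have hC0 : 0 < C := by positivity
  have hδ0 : 0 < δ := by positivity
  have hδ1 : δ ≤ 1 := by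
    rw [hδ, div_le_one (by positivity)]
    exact one_le_pow₀ one_le_two
  have hmz : 0 < mzConst s c C := mzConst_pos s hC0 hc0
  have hd0 : (0 : ℝ) < d := by exact_mod_cast (by lia : 0 < d)
  have hnc : 0 ≤ newtonConst d s c C := by
    have := oscConst_pos (s + 1)
    unfold newtonConst
    positivity
  set q : ℝ := 12 * 3 ^ (s + 1) * mzConst s c C with hq
  have hq0 : 0 < q := by positivity
  obtain ⟨t₁, ht₁⟩ := exists_pow_two_mul_le
    (4 / δ + 2 * d ^ 2 * q + 2 * newtonConst d s c C * q + 32 * d ^ 2 * q / δ) 1 one_pos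
  set κ : ℝ := 1 / 2 ^ t₁ with hκ
  have hκ0 : 0 < κ := by positivity
  have e1 : 0 ≤ 4 / δ * κ := by positivity
  have e2 : 0 ≤ 2 * d ^ 2 * q * κ := by positivity
  have e3 : 0 ≤ 2 * newtonConst d s c C * q * κ := by positivity
  have e4 : 0 ≤ 32 * d ^ 2 * q / δ * κ := by positivity
  have e5 : 4 / δ * κ ≤ 1 ∧ 2 * d ^ 2 * q * κ ≤ 1 ∧ 2 * newtonConst d s c C * q * κ ≤ 1 ∧
      32 * d ^ 2 * q / δ * κ ≤ 1 := by
    refine ⟨?_, ?_, ?_, ?_⟩ <;> nlinarith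
  obtain ⟨f1, f2, f3, f4⟩ := e5
  have g1 : κ ≤ δ / 4 := by
    have : κ = 4 / δ * κ * (δ / 4) := by field_simp
    rw [this]
    exact mul_le_of_le_one_left (by positivity) f1
  have g4 : 4 * d ^ 2 * (q * κ) ≤ δ / 8 := by
    have : 4 * d ^ 2 * (q * κ) = 32 * d ^ 2 * q / δ * κ * (δ / 8) := by field_simp; norm_num
    rw [this]
    exact mul_le_of_le_one_left (by positivity) f4
  refine ⟨δ, c, C, 2 * D ^ (t₁ + 2) + 8 * D ^ (t + 1), hC0, hc0, hδ1, ht, by positivity, ?_⟩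
  intro ν _ hνS hdbl n k hn hK
  have hn' : (0 : ℝ) < n := by exact_mod_cast hn
  have hDa : 0 < D ^ (t₁ + 2) := by positivity
  have hDb : 0 < D ^ (t + 1) := by positivity
  obtain ⟨z, hz, hU, hL, hE⟩ := exists_initial_nodes hd (k := k) hn (ρ := κ / n) (by positivity)
    (by rw [← mul_div_assoc]; gcongr; linarith) hνS (fun x hx => by
      have h1 : Metric.closedBall x (κ / n / 4) ⊆ Metric.ball x (κ / n / 2) := by
        refine Metric.closedBall_subset_ball ?_
        have : 0 < κ / n := by positivity
        linarith
      have h2 := measureReal_closedBall_le (by positivity) hdbl hx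
        (show 0 < κ / n / 4 by positivity) (t₁ + 2)
      have h3 : (2 : ℝ) ^ (t₁ + 2) * (κ / n / 4) = 1 / n := by
        rw [hκ]
        field_simp
        ring
      rw [h3] at h2
      have h4 : ν.real (Metric.closedBall x (1 / n))
          ≤ D ^ (t₁ + 2) * ν.real (Metric.ball x (κ / n / 2)) :=
        h2.trans (mul_le_mul_of_nonneg_left (measureReal_mono h1) hDa.le)
      have h5 : 2 * D ^ (t₁ + 2) ≤ k * (D ^ (t₁ + 2) * ν.real (Metric.ball x (κ / n / 2))) := by
        have : k * ν.real (Metric.closedBall x (1 / n))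
          ≤ k * (D ^ (t₁ + 2) * ν.real (Metric.ball x (κ / n / 2))) := by gcongr
        linarith [hK x hx]
      refine le_of_mul_le_mul_left (a := D ^ (t₁ + 2)) ?_ hDa
      linarith)
  have hdens : ∀ (A : Finset (Fin k)) (z' : Fin k → EuclideanSpace ℝ (Fin d)), Aᶜ.card ≤ 2 →
      (∀ i, z' i ∈ unitSphere d) → (∀ i, ‖z i - z' i‖ < δ / 4 / n) →
      NodeDensity n s δ c C (fun x => k * ν.real (Metric.closedBall x (1 / n))) A z' :=
    fun A z' hA hz' hzz' => nodeDensity_of_card_bounds hn (by gcongr) hdbl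
      (fun x hx => by linarith [hK x hx]) hU hL hz' (fun i => (hzz' i).le) hA
  have hε : 4 * d ^ 2 * (q * κ / n) < δ / 4 / n := by
    have : 4 * d ^ 2 * (q * κ / n) = 4 * d ^ 2 * (q * κ) / n := by ring
    rw [this]
    gcongr
    linarith
  have hself : NodeDensity n s δ c C (fun x => k * ν.real (Metric.closedBall x (1 / n)))
      Finset.univ z := hdens _ _ (by simp) hz fun i => by
    rw [sub_self, norm_zero]
    positivity
  obtain ⟨z', hz', hzz', -, hex⟩ := exists_exact_of_almost (A := Finset.univ) (ε := q * κ / n)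
    (I := (k : ℝ) • pIntegral ν hνS) (s := s) (δ := δ)
    (V := fun x => k * ν.real (Metric.closedBall x (1 / n))) hn hC0 hc0 hδ1 ht hz
    (by positivity)
    (by
      have : 2 * d ^ 2 * (q * κ / n) * n = 2 * d ^ 2 * q * κ := by field_simp
      rw [this]
      exact f2)
    (by
      have : newtonConst d s c C * n * (q * κ / n) = 1 / 2 * (2 * newtonConst d s c C * q * κ) := by
        field_simp
      rw [this]
      linarith)
    (fun z' hz' hzz' => hdens _ _ (by simp) hz' fun i => (hzz' i).trans_lt hε)
    (fun P hP => by
      refine (hE (s + 1) P).trans ?_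
      calc 12 * 3 ^ (s + 1) * (κ / n) * ∑ i, gradMax (s + 1) n P (z i)
          ≤ 12 * 3 ^ (s + 1) * (κ / n) * (mzConst s c C * ∑ i, gradSize P (z i)) := by
            gcongr
            exact hself.sum_gradMax_le hn hC0 hc0 hδ1 ht hP
        _ = _ := by
            rw [hq]
            ring)
  exact ⟨δ / 4 / n, z, z', hz', fun i => (hzz' i).trans_lt hε,
    fun P hP => hex P hP, hdens⟩

lemma exists_mem_unitSphere_near (hd : 2 ≤ d) {x : EuclideanSpace ℝ (Fin d)}
    (hx : x ∈ unitSphere d) {η : ℝ} (hη : 0 < η) (F : Finset (EuclideanSpace ℝ (Fin d))) :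
    ∃ u ∈ unitSphere d, ‖u - x‖ < η ∧ u ∉ F := by
  classical
  obtain ⟨t, ht, htF⟩ := (Ioo_infinite (lt_min hη two_pos)).exists_notMem_finset
    (F.image fun u => ‖u - x‖)
  have hnx : -x ∈ unitSphere d := by simpa [unitSphere] using hx
  have hivt := (isPreconnected_unitSphere hd).intermediate_value hx hnx
    (f := fun u => ‖u - x‖) (by fun_prop)
  have h2 : ‖-x - x‖ = 2 := by
    rw [show -x - x = (-2 : ℝ) • x by module, norm_smul, norm_eq_one_of_mem hx]
    norm_num
  have htm : t ∈ Icc ‖x - x‖ ‖-x - x‖ := by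
    rw [h2, sub_self, norm_zero]
    exact ⟨ht.1.le, ht.2.le.trans (min_le_right _ _)⟩
  obtain ⟨u, hu, hut⟩ := hivt htm
  refine ⟨u, hu, ?_, fun hF => htF (Finset.mem_image.2 ⟨u, hF, hut⟩)⟩
  simp only at hut
  rw [hut]
  exact ht.2.trans_le (min_le_left _ _)

/-- Points of the sphere off the coordinate hyperplanes and off a finite set are dense. -/
lemma exists_generic_near (hd : 2 ≤ d) {x : EuclideanSpace ℝ (Fin d)}
    (hx : x ∈ unitSphere d) {η : ℝ} (hη : 0 < η) (F : Finset (EuclideanSpace ℝ (Fin d))) :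
    ∃ u ∈ unitSphere d, ‖x - u‖ ≤ η ∧ u ∉ F ∧ ∀ a, u a ≠ 0 := by
  set e : EuclideanSpace ℝ (Fin d) := WithLp.toLp 2 fun a => if 0 ≤ x a then 1 else -1 with he
  have hx1 := norm_eq_one_of_mem hx
  have hcont : ContinuousAt (fun t : ℝ => ‖x + t • e‖⁻¹ • (x + t • e)) 0 := by
    have h1 : ContinuousAt (fun t : ℝ => x + t • e) 0 := by fun_prop
    refine (h1.norm.inv₀ ?_).smul h1
    simp [hx1]
  have hlim : Filter.Tendsto (fun t : ℝ => ‖x + t • e‖⁻¹ • (x + t • e)) (nhdsWithin 0 (Ioi 0))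
      (nhds x) := by
    have := hcont.tendsto.mono_left (nhdsWithin_le_nhds (s := Ioi 0))
    simpa [hx1] using this
  obtain ⟨t, ht1, ht0⟩ := ((hlim.eventually (Metric.ball_mem_nhds x (half_pos hη))).and
    self_mem_nhdsWithin).exists
  have hcoord : ∀ a, (x + t • e) a ≠ 0 := by
    intro a
    simp only [he, PiLp.add_apply, PiLp.smul_apply, smul_eq_mul]
    split_ifs with h
    · have : 0 < x a + t * 1 := by linarith
      exact this.ne'
    · have : x a + t * -1 < 0 := by linarith
      exact this.ne
  have hne : x + t • e ≠ 0 := by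
    intro h
    have := hcoord ⟨0, by lia⟩
    rw [h] at this
    exact this rfl
  have hn0 : ‖x + t • e‖ ≠ 0 := norm_ne_zero_iff.2 hne
  set u₀ := ‖x + t • e‖⁻¹ • (x + t • e) with hu₀
  have hu₀S : u₀ ∈ unitSphere d := by
    rw [unitSphere, mem_sphere_zero_iff_norm, hu₀, norm_smul, norm_inv, norm_norm,
      inv_mul_cancel₀ hn0]
  have hopen : IsOpen {u : EuclideanSpace ℝ (Fin d) | ∀ a, u a ≠ 0} := by
    rw [ofPred_forall]
    refine isOpen_iInter_of_finite fun a => ?_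
    exact isOpen_ne_fun (by fun_prop) continuous_const
  have hmem : u₀ ∈ {u : EuclideanSpace ℝ (Fin d) | ∀ a, u a ≠ 0} := by
    intro a
    rw [hu₀, PiLp.smul_apply, smul_eq_mul]
    exact mul_ne_zero (inv_ne_zero hn0) (hcoord a)
  obtain ⟨r, hr, hball⟩ := Metric.isOpen_iff.1 hopen u₀ hmem
  obtain ⟨u, huS, hu, huF⟩ := exists_mem_unitSphere_near hd hu₀S (lt_min hr (half_pos hη)) F
  refine ⟨u, huS, ?_, huF, hball ?_⟩
  · rw [dist_comm, dist_eq_norm] at ht1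
    have h1 := norm_sub_le_norm_sub_add_norm_sub x u₀ u
    have h2 := hu.trans_le (min_le_right _ _)
    rw [norm_sub_rev] at h2
    linarith
  · rw [Metric.mem_ball, dist_eq_norm]
    exact hu.trans_le (min_le_left _ _)

/-- Prescribed small displacements of at most two nodes can be compensated by the others. -/
lemma exists_exact_of_displacement {n k s : ℕ} {δ c C R : ℝ}
    {V : EuclideanSpace ℝ (Fin d) → ℝ} {I : MvPolynomial (Fin d) ℝ →ₗ[ℝ] ℝ}
    (hn : 0 < n) (hC : 0 < C) (hc : 0 < c) (hδ1 : δ ≤ 1)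
    (hδ : 2 * d ^ 2 * oscConst (s + 1) * δ ≤ 1 / 2) {z₀ z : Fin k → EuclideanSpace ℝ (Fin d)}
    (hdens : ∀ (A : Finset (Fin k)) (z' : Fin k → EuclideanSpace ℝ (Fin d)), Aᶜ.card ≤ 2 →
      (∀ i, z' i ∈ unitSphere d) → (∀ i, ‖z₀ i - z' i‖ < R) → NodeDensity n s δ c C V A z')
    (hz : ∀ i, z i ∈ unitSphere d) (hzR : ∀ i, ‖z₀ i - z i‖ < R)
    (hex : ∀ P : MvPolynomial (Fin d) ℝ, P.totalDegree ≤ n → ∑ i, pEval P (z i) = I P)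
    {e : ℝ} (he : 0 < e) :
    ∃ η > 0, ∀ (B : Finset (Fin k)) (y : Fin k → EuclideanSpace ℝ (Fin d)), B.card ≤ 2 →
      (∀ i, y i ∈ unitSphere d) → (∀ i, ‖z i - y i‖ ≤ η) → (∀ i ∉ B, y i = z i) →
      ∃ z' : Fin k → EuclideanSpace ℝ (Fin d), (∀ i, z' i ∈ unitSphere d) ∧
        (∀ i, ‖z i - z' i‖ < e) ∧ (∀ i, ‖z₀ i - z' i‖ < R) ∧ (∀ i ∈ B, z' i = y i) ∧
        ∀ P : MvPolynomial (Fin d) ℝ, P.totalDegree ≤ n → ∑ i, pEval P (z' i) = I P := by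
  classical
  have hn' : (0 : ℝ) < n := by exact_mod_cast hn
  have hmz : 0 < mzConst s c C := mzConst_pos s hC hc
  set G : ℝ := 4 * 3 ^ (s + 1) * (1 + n * 2) ^ (s + 1) * mzConst s c C with hG
  have hG0 : 0 < G := by positivity
  have hlin : ∀ a b : ℝ, 0 < b → ∀ᶠ η in nhdsWithin (0 : ℝ) (Ioi 0), a * η < b := by
    intro a b hb
    have : Filter.Tendsto (fun η : ℝ => a * η) (nhdsWithin 0 (Ioi 0)) (nhds 0) := by
      have h : Continuous fun η : ℝ => a * η := by fun_prop
      simpa using (h.tendsto 0).mono_left (nhdsWithin_le_nhds (s := Ioi 0))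
    exact this.eventually (gt_mem_nhds hb)
  have hpos : ∀ᶠ η in nhdsWithin (0 : ℝ) (Ioi 0), 0 < η := self_mem_nhdsWithin
  obtain ⟨η, e0, e1, e2, e3, e4, e5⟩ := (hpos.and <| (hlin 1 (1 / n) (by positivity)).and <|
    (hlin (2 * d ^ 2 * G * n) 1 one_pos).and <|
    (hlin (newtonConst d s c C * n * G) (1 / 2) (by norm_num)).and <|
    (hlin (1 + 4 * d ^ 2 * G) e he).and <| Filter.eventually_all.2 fun i : Fin k =>
      hlin (1 + 4 * d ^ 2 * G) (R - ‖z₀ i - z i‖) (sub_pos.2 (hzR i))).exists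
  refine ⟨η, e0, fun B y hB hy hzy hyB => ?_⟩
  have hBc : Bᶜᶜ.card ≤ 2 := by rwa [compl_compl]
  have htri : ∀ z' : Fin k → EuclideanSpace ℝ (Fin d), (∀ i, ‖y i - z' i‖ ≤ 4 * d ^ 2 * (G * η)) →
      (∀ i, ‖z i - z' i‖ < e) ∧ (∀ i, ‖z₀ i - z' i‖ < R) := by
    intro z' hz'
    have h1 : ∀ i, ‖z i - z' i‖ ≤ (1 + 4 * d ^ 2 * G) * η := fun i => by
      have := norm_sub_le_norm_sub_add_norm_sub (z i) (y i) (z' i)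
      linarith [hz' i, hzy i]
    refine ⟨fun i => (h1 i).trans_lt e4, fun i => ?_⟩
    have := norm_sub_le_norm_sub_add_norm_sub (z₀ i) (z i) (z' i)
    linarith [h1 i, e5 i]
  have hzd := hdens Bᶜ z hBc hz hzR
  obtain ⟨z', hz'S, hz'y, hz'B, hz'ex⟩ := exists_exact_of_almost (A := Bᶜ) (ε := G * η)
    (I := I) (s := s) (δ := δ) (V := V) hn hC hc hδ1 hδ hy (by positivity)
    (by linarith) (by linarith)
    (fun z' hz' hyz' => hdens Bᶜ z' hBc hz' (htri z' hyz').2)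
    (fun P hP => by
      have hmax := gradMax_nonneg (s + 1) n P
      have hS : ∀ i, gradMax (s + 1) n P (z i)
          ≤ (1 + n * 2) ^ (s + 1) * (mzConst s c C * ∑ a ∈ Bᶜ, gradSize P (y a)) := by
        intro i
        have hne : (Bᶜ : Finset (Fin k)).Nonempty := by
          have h1 := hzd.lower (z i) (hz i)
          have h2 : 0 < c * V (z i) := mul_pos hc (hzd.pos _ (hz i))
          have h3 : 0 < ((Bᶜ).filter fun a => ‖z a - z i‖ ≤ δ / n).card := by
            exact_mod_cast h2.trans_le h1
          exact (Finset.card_pos.1 h3).mono (Finset.filter_subset _ _)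
        obtain ⟨a, ha⟩ := hne
        have h4 : ∑ a ∈ Bᶜ, gradSize P (y a) = ∑ a ∈ Bᶜ, gradSize P (z a) :=
          Finset.sum_congr rfl fun b hb => by rw [hyB b (Finset.mem_compl.1 hb)]
        rw [h4]
        calc gradMax (s + 1) n P (z i)
            ≤ (1 + n * ‖z i - z a‖) ^ (s + 1) * gradMax (s + 1) n P (z a) :=
              gradMax_le _ _ _ (hz i) _
          _ ≤ (1 + n * 2) ^ (s + 1) * ∑ a ∈ Bᶜ, gradMax (s + 1) n P (z a) := by
              have h5 := norm_sub_le_two (hz i) (hz a)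
              have h6 := Finset.single_le_sum (fun b _ => hmax (z b)) ha
              have := hmax (z a)
              gcongr
          _ ≤ _ := by
              gcongr
              exact hzd.sum_gradMax_le hn hC hc hδ1 hδ hP
      set T := ∑ a ∈ Bᶜ, gradSize P (y a) with hT
      have hT0 : 0 ≤ T := Finset.sum_nonneg fun a _ => gradSize_nonneg P (y a)
      rw [← hex P hP, ← Finset.sum_sub_distrib]
      have h7 : ∑ i, (pEval P (y i) - pEval P (z i)) = ∑ i ∈ B, (pEval P (y i) - pEval P (z i)) :=
        (Finset.sum_subset (Finset.subset_univ B) fun i _ hi => by rw [hyB i hi, sub_self]).symm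
      rw [h7]
      have h8 : ∀ i ∈ B, |pEval P (y i) - pEval P (z i)|
          ≤ 2 * 3 ^ (s + 1) * ((1 + n * 2) ^ (s + 1) * (mzConst s c C * T)) * η := by
        intro i _
        have h9 := abs_pEval_sub_le hn (s + 1) P (hz i) (hy i) ((hzy i).trans (by linarith))
        refine h9.trans ?_
        have := hmax (z i)
        gcongr
        · exact hS i
        · exact hzy i
      refine (Finset.abs_sum_le_sum_abs _ _).trans ((Finset.sum_le_sum h8).trans ?_)
      rw [Finset.sum_const, nsmul_eq_mul]
      calc (B.card : ℝ) * (2 * 3 ^ (s + 1) * ((1 + n * 2) ^ (s + 1) * (mzConst s c C * T)) * η)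
          ≤ 2 * (2 * 3 ^ (s + 1) * ((1 + n * 2) ^ (s + 1) * (mzConst s c C * T)) * η) := by
            gcongr
            exact_mod_cast hB
        _ = G * η * T := by
            rw [hG]
            ring)
  obtain ⟨t1, t2⟩ := htri z' hz'y
  exact ⟨z', hz'S, t1, t2, fun i hi => hz'B i (by simpa using hi), hz'ex⟩

lemma continuous_lastNeg : Continuous (lastNeg d) := by
  unfold lastNeg
  refine (EuclideanSpace.equiv (Fin d) ℝ).symm.continuous.comp (continuous_pi fun i => ?_)
  split_ifs <;> fun_prop

/-- Exact nodes can be chosen off the coordinate hyperplanes, with distinct orbits under the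
reflection. -/
lemma exists_generic_exact (hd : 2 ≤ d) {n k s : ℕ} {δ c C R : ℝ}
    {V : EuclideanSpace ℝ (Fin d) → ℝ} {I : MvPolynomial (Fin d) ℝ →ₗ[ℝ] ℝ}
    (hn : 0 < n) (hC : 0 < C) (hc : 0 < c) (hδ1 : δ ≤ 1)
    (hδ : 2 * d ^ 2 * oscConst (s + 1) * δ ≤ 1 / 2) {z₀ z : Fin k → EuclideanSpace ℝ (Fin d)}
    (hdens : ∀ (A : Finset (Fin k)) (z' : Fin k → EuclideanSpace ℝ (Fin d)), Aᶜ.card ≤ 2 →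
      (∀ i, z' i ∈ unitSphere d) → (∀ i, ‖z₀ i - z' i‖ < R) → NodeDensity n s δ c C V A z')
    (hz : ∀ i, z i ∈ unitSphere d) (hzR : ∀ i, ‖z₀ i - z i‖ < R)
    (hex : ∀ P : MvPolynomial (Fin d) ℝ, P.totalDegree ≤ n → ∑ i, pEval P (z i) = I P) :
    ∃ z' : Fin k → EuclideanSpace ℝ (Fin d), (∀ i, z' i ∈ unitSphere d) ∧
      (∀ i a, z' i a ≠ 0) ∧ (∀ i j, i ≠ j → z' i ≠ z' j ∧ z' i ≠ lastNeg d (z' j)) ∧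
      ∀ P : MvPolynomial (Fin d) ℝ, P.totalDegree ≤ n → ∑ i, pEval P (z' i) = I P := by
  classical
  set good : Fin k × Fin k → Set (Fin k → EuclideanSpace ℝ (Fin d)) := fun p =>
    {z | (∀ a, z p.1 a ≠ 0) ∧ (p.1 ≠ p.2 → z p.1 ≠ z p.2 ∧ z p.1 ≠ lastNeg d (z p.2))} with hgood
  have hopen : ∀ p, IsOpen (good p) := by
    intro p
    have hl := continuous_lastNeg (d := d)
    rw [hgood]
    simp only [ofPred_and, ofPred_forall]
    refine (isOpen_iInter_of_finite fun a => isOpen_ne_fun (by fun_prop) continuous_const).inter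
      (isOpen_iInter_of_finite fun _ => (isOpen_ne_fun (by fun_prop) (by fun_prop)).inter
        (isOpen_ne_fun (by fun_prop) (by fun_prop)))
  set bad : (Fin k → EuclideanSpace ℝ (Fin d)) → Finset (Fin k × Fin k) := fun z =>
    Finset.univ.filter fun p => z ∉ good p with hbad
  set X : Set (Fin k → EuclideanSpace ℝ (Fin d)) :=
    {z | (∀ i, z i ∈ unitSphere d) ∧ (∀ i, ‖z₀ i - z i‖ < R) ∧
      ∀ P : MvPolynomial (Fin d) ℝ, P.totalDegree ≤ n → ∑ i, pEval P (z i) = I P} with hX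
  have hXne : X.Nonempty := ⟨z, hz, hzR, hex⟩
  set y := Function.argminOn (fun z => (bad z).card) X hXne with hy
  obtain ⟨hyS, hyR, hyex⟩ : y ∈ X := Function.argminOn_mem _ X hXne
  have hmin : ∀ z ∈ X, (bad y).card ≤ (bad z).card := fun z hz =>
    Function.argminOn_le (fun z => (bad z).card) X hz
  have hall : ∀ p, y ∈ good p := by
    by_contra! hp
    obtain ⟨p, hp⟩ := hp
    set W : Set (Fin k → EuclideanSpace ℝ (Fin d)) := ⋂ q ∈ {q | y ∈ good q}, good q with hW
    have hWo : IsOpen W := (Set.toFinite _).isOpen_biInter fun q _ => hopen q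
    have hyW : y ∈ W := mem_iInter₂.2 fun q hq => hq
    obtain ⟨e, he, hball⟩ := Metric.isOpen_iff.1 hWo y hyW
    obtain ⟨η, hη, hmove⟩ := exists_exact_of_displacement hn hC hc hδ1 hδ hdens hyS hyR hyex he
    obtain ⟨u, huS, huy, huF, hu0⟩ := exists_generic_near hd (hyS p.1) hη
      {y p.2, lastNeg d (y p.2)}
    simp only [Finset.mem_insert, Finset.mem_singleton, not_or] at huF
    obtain ⟨z', hz'S, hz'y, hz'R, hz'B, hz'ex⟩ := hmove {p.1, p.2} (Function.update y p.1 u)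
      Finset.card_le_two
      (fun i => by
        by_cases h : i = p.1
        · rw [h, Function.update_self]
          exact huS
        · rw [Function.update_of_ne h]
          exact hyS i)
      (fun i => by
        by_cases h : i = p.1
        · rw [h, Function.update_self]
          exact huy
        · rw [Function.update_of_ne h, sub_self, norm_zero]
          exact hη.le)
      (fun i hi => by
        rw [Function.update_of_ne]
        rintro rfl
        simp at hi)
    have hz'W : z' ∈ W := by
      refine hball ?_
      rw [Metric.mem_ball, dist_comm, dist_pi_lt_iff he]
      intro i
      rw [dist_eq_norm]
      exact hz'y i
    have h1 : z' p.1 = u := by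
      rw [hz'B p.1 (by simp), Function.update_self]
    have hz'p : z' ∈ good p := by
      refine ⟨?_, fun h => ?_⟩
      · rw [h1]
        exact hu0
      · have h2 : z' p.2 = y p.2 := by
          rw [hz'B p.2 (by simp), Function.update_of_ne h.symm]
        rw [h1, h2]
        exact huF
    have hlt : (bad z').card < (bad y).card := by
      refine Finset.card_lt_card (Finset.ssubset_iff_of_subset ?_ |>.2 ⟨p, ?_, ?_⟩)
      · intro q hq
        simp only [hbad, Finset.mem_filter, Finset.mem_univ, true_and] at hq ⊢
        exact fun hyq => hq (mem_iInter₂.1 hz'W q hyq)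
      · simpa [hbad] using hp
      · simpa [hbad] using hz'p
    exact absurd (hmin z' ⟨hz'S, hz'R, hz'ex⟩) (not_le.2 hlt)
  exact ⟨y, hyS, fun i => (hall (i, i)).1, fun i j h => (hall (i, j)).2 h, hyex⟩

lemma cos_gdist {x y : EuclideanSpace ℝ (Fin d)} (hx : x ∈ unitSphere d) (hy : y ∈ unitSphere d) :
    Real.cos (gdist x y) = ⟪x, y⟫_ℝ := by
  have h := abs_le.1 (abs_real_inner_le_norm x y)
  rw [norm_eq_one_of_mem hx, norm_eq_one_of_mem hy, mul_one] at h
  exact Real.cos_arccos h.1 h.2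

lemma norm_sub_sq_eq_gdist {x y : EuclideanSpace ℝ (Fin d)} (hx : x ∈ unitSphere d)
    (hy : y ∈ unitSphere d) : ‖x - y‖ ^ 2 = 2 - 2 * Real.cos (gdist x y) := by
  rw [norm_sub_sq_real, norm_eq_one_of_mem hx, norm_eq_one_of_mem hy, cos_gdist hx hy]
  ring

lemma norm_sub_le_gdist {x y : EuclideanSpace ℝ (Fin d)} (hx : x ∈ unitSphere d)
    (hy : y ∈ unitSphere d) : ‖x - y‖ ≤ gdist x y := by
  refine le_of_sq_le_sq ?_ (Real.arccos_nonneg _)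
  rw [norm_sub_sq_eq_gdist hx hy]
  linarith [Real.one_sub_sq_div_two_le_cos (x := gdist x y)]

lemma gdist_le_two_mul_norm_sub {x y : EuclideanSpace ℝ (Fin d)} (hx : x ∈ unitSphere d)
    (hy : y ∈ unitSphere d) : gdist x y ≤ 2 * ‖x - y‖ := by
  refine le_of_sq_le_sq ?_ (by positivity)
  have h0 : 0 ≤ gdist x y := Real.arccos_nonneg _
  have h1 : gdist x y ≤ π := Real.arccos_le_pi _
  have h3 := Real.cos_le_one_sub_mul_cos_sq (x := gdist x y) (by rwa [abs_of_nonneg h0])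
  rw [mul_pow, norm_sub_sq_eq_gdist hx hy]
  have h4 : (1 : ℝ) / 16 ≤ 1 / π ^ 2 := by
    refine one_div_le_one_div_of_le (by positivity) ?_
    nlinarith [Real.pi_pos, Real.pi_le_four]
  have h5 : 2 / π ^ 2 * gdist x y ^ 2 = 2 * (1 / π ^ 2 * gdist x y ^ 2) := by ring
  have h6 : 1 / 16 * gdist x y ^ 2 ≤ 1 / π ^ 2 * gdist x y ^ 2 := by gcongr
  linarith

lemma cap_subset_closedBall {x : EuclideanSpace ℝ (Fin d)} (hx : x ∈ unitSphere d) (r : ℝ) :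
    cap x r ⊆ Metric.closedBall x r := by
  intro y hy
  rw [Metric.mem_closedBall, dist_comm, dist_eq_norm]
  exact (norm_sub_le_gdist hx hy.1).trans hy.2

lemma closedBall_inter_subset_cap {x : EuclideanSpace ℝ (Fin d)} (hx : x ∈ unitSphere d) (r : ℝ) :
    Metric.closedBall x r ∩ unitSphere d ⊆ cap x (2 * r) := by
  rintro y ⟨hy, hyS⟩
  rw [Metric.mem_closedBall, dist_comm, dist_eq_norm] at hy
  exact ⟨hyS, (gdist_le_two_mul_norm_sub hx hyS).trans (by linarith)⟩

lemma measurableSet_cap (x : EuclideanSpace ℝ (Fin d)) (r : ℝ) : MeasurableSet (cap x r) := by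
  have h : IsClosed {y : EuclideanSpace ℝ (Fin d) | gdist x y ≤ r} :=
    isClosed_le (Real.continuous_arccos.comp (by fun_prop)) continuous_const
  exact (Metric.isClosed_sphere.inter h).measurableSet

lemma ae_mem_unitSphere : ∀ᵐ y ∂(sphMeasure d), y ∈ unitSphere d :=
  ae_restrict_mem Metric.isClosed_sphere.measurableSet

lemma lastNeg_apply (x : EuclideanSpace ℝ (Fin d)) (i : Fin d) :
    lastNeg d x i = if (i : ℕ) = d - 1 then -(x i) else x i := rfl

lemma lastNeg_involutive : Function.Involutive (lastNeg d) := by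
  intro x
  ext i
  simp only [lastNeg_apply]
  split_ifs <;> simp

lemma isometry_lastNeg : Isometry (lastNeg d) := by
  refine Isometry.of_dist_eq fun x y => ?_
  rw [EuclideanSpace.dist_eq, EuclideanSpace.dist_eq]
  congr 1
  refine Finset.sum_congr rfl fun i _ => ?_
  simp only [lastNeg_apply]
  split_ifs
  · rw [dist_neg_neg]
  · rfl

lemma norm_lastNeg (x : EuclideanSpace ℝ (Fin d)) : ‖lastNeg d x‖ = ‖x‖ := by
  have h0 : lastNeg d 0 = 0 := by
    ext i
    simp [lastNeg_apply]
  have := isometry_lastNeg.dist_eq x 0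
  rwa [h0, dist_zero_right, dist_zero_right] at this

lemma lastNeg_mem_unitSphere {x : EuclideanSpace ℝ (Fin d)} :
    lastNeg d x ∈ unitSphere d ↔ x ∈ unitSphere d := by
  simp [unitSphere, norm_lastNeg]

/-- The reflection in the last coordinate as an isometric equivalence. -/
def lastNegEquiv (d : ℕ) : EuclideanSpace ℝ (Fin d) ≃ᵢ EuclideanSpace ℝ (Fin d) where
  toEquiv := lastNeg_involutive.toPerm
  isometry_toFun := isometry_lastNeg

lemma integral_comp_lastNeg (f : EuclideanSpace ℝ (Fin d) → ℝ) :
    ∫ x, f (lastNeg d x) ∂(sphMeasure d) = ∫ x, f x ∂(sphMeasure d) := by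
  have h1 := (lastNegEquiv d).measurePreserving_hausdorffMeasure ((d : ℝ) - 1)
  have h2 := h1.restrict_preimage (s := unitSphere d) Metric.isClosed_sphere.measurableSet
  have h3 : (lastNegEquiv d) ⁻¹' unitSphere d = unitSphere d := by
    ext x
    exact lastNeg_mem_unitSphere
  rw [h3] at h2
  exact h2.integral_comp (lastNegEquiv d).toHomeomorph.measurableEmbedding f

/-- The composition of a polynomial with the reflection in the last coordinate. -/
def polyLastNeg (P : MvPolynomial (Fin d) ℝ) : MvPolynomial (Fin d) ℝ :=
  MvPolynomial.bind₁
    (fun i : Fin d => if (i : ℕ) = d - 1 then -MvPolynomial.X i else MvPolynomial.X i) P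

lemma pEval_polyLastNeg (P : MvPolynomial (Fin d) ℝ) (x : EuclideanSpace ℝ (Fin d)) :
    pEval (polyLastNeg P) x = pEval P (lastNeg d x) := by
  unfold pEval polyLastNeg
  rw [MvPolynomial.eval, MvPolynomial.eval₂Hom_bind₁]
  congr 2
  funext i
  rw [lastNeg_apply]
  split_ifs <;> simp

lemma totalDegree_polyLastNeg_le {n : ℕ} {P : MvPolynomial (Fin d) ℝ} (hP : P.totalDegree ≤ n) :
    (polyLastNeg P).totalDegree ≤ n := by
  unfold polyLastNeg
  conv_lhs => rw [P.as_sum]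
  rw [map_sum]
  refine MvPolynomial.totalDegree_finsetSum_le fun m hm => ?_
  rw [MvPolynomial.bind₁_monomial]
  refine (MvPolynomial.totalDegree_mul _ _).trans ?_
  rw [MvPolynomial.totalDegree_C, zero_add]
  refine (MvPolynomial.totalDegree_finsetProd _ _).trans ?_
  refine le_trans ?_ ((MvPolynomial.le_totalDegree hm).trans hP)
  refine Finset.sum_le_sum fun i _ => (MvPolynomial.totalDegree_pow _ _).trans ?_
  split_ifs <;> simp

section Density

variable {w : EuclideanSpace ℝ (Fin d) → ℝ}

lemma measureReal_withDensity_eq_wMass (hw : ∀ x, 0 ≤ w x) (hwi : Integrable w (sphMeasure d))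
    {A : Set (EuclideanSpace ℝ (Fin d))} (hA : MeasurableSet A) :
    ((sphMeasure d).withDensity fun x => ENNReal.ofReal (w x)).real A = wMass w A := by
  rw [Measure.real, withDensity_apply _ hA, wMass, ← ofReal_integral_eq_lintegral_ofReal
    hwi.integrableOn (Filter.Eventually.of_forall hw), ENNReal.toReal_ofReal (integral_nonneg hw)]

lemma ae_withDensity_mem_unitSphere :
    ∀ᵐ y ∂((sphMeasure d).withDensity fun x => ENNReal.ofReal (w x)), y ∈ unitSphere d :=
  (withDensity_absolutelyContinuous _ _).ae_le ae_mem_unitSphere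

lemma isProbabilityMeasure_withDensity (hw : ∀ x, 0 ≤ w x) (hwi : Integrable w (sphMeasure d))
    (hw1 : wMass w (unitSphere d) = 1) :
    IsProbabilityMeasure ((sphMeasure d).withDensity fun x => ENNReal.ofReal (w x)) := by
  refine ⟨?_⟩
  have h : (sphMeasure d).restrict (unitSphere d) = sphMeasure d :=
    Measure.restrict_eq_self_of_ae_mem ae_mem_unitSphere
  rw [wMass, h] at hw1
  rw [withDensity_apply _ MeasurableSet.univ, Measure.restrict_univ,
    ← ofReal_integral_eq_lintegral_ofReal hwi (Filter.Eventually.of_forall hw), hw1,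
    ENNReal.ofReal_one]

lemma integral_withDensity_eq (hw : ∀ x, 0 ≤ w x) (hwi : Integrable w (sphMeasure d))
    (f : EuclideanSpace ℝ (Fin d) → ℝ) :
    ∫ x, f x ∂((sphMeasure d).withDensity fun x => ENNReal.ofReal (w x))
      = ∫ x, f x * w x ∂(sphMeasure d) := by
  rw [integral_withDensity_eq_integral_toReal_smul₀ hwi.aemeasurable.ennreal_ofReal
    (Filter.Eventually.of_forall fun _ => ENNReal.ofReal_lt_top)]
  refine integral_congr_ae (Filter.Eventually.of_forall fun x => ?_)
  simp only [smul_eq_mul]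
  rw [ENNReal.toReal_ofReal (hw x), mul_comm]

lemma measureReal_closedBall_two_mul_le (hw : ∀ x, 0 ≤ w x) (hwi : Integrable w (sphMeasure d))
    (hw1 : wMass w (unitSphere d) = 1) {L : ℝ}
    (hdbl : ∀ x ∈ unitSphere d, ∀ r : ℝ, 0 < r →
      wMass w (cap x (2 * r)) ≤ L * wMass w (cap x r))
    {x : EuclideanSpace ℝ (Fin d)} (hx : x ∈ unitSphere d) {r : ℝ} (hr : 0 < r) :
    ((sphMeasure d).withDensity fun x => ENNReal.ofReal (w x)).real (Metric.closedBall x (2 * r))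
      ≤ |L| ^ 2 * ((sphMeasure d).withDensity fun x => ENNReal.ofReal (w x)).real
        (Metric.closedBall x r) := by
  have := isProbabilityMeasure_withDensity hw hwi hw1
  set ν := (sphMeasure d).withDensity fun x => ENNReal.ofReal (w x) with hν
  have hcap : ∀ t, wMass w (cap x t) = ν.real (cap x t) := fun t =>
    (measureReal_withDensity_eq_wMass hw hwi (measurableSet_cap x t)).symm
  have hstep : ∀ t, 0 < t → ν.real (cap x (2 * t)) ≤ |L| * ν.real (cap x t) := by
    intro t ht
    rw [← hcap, ← hcap]
    refine (hdbl x hx t ht).trans ?_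
    have : 0 ≤ wMass w (cap x t) := by
      rw [hcap]
      exact measureReal_nonneg
    gcongr
    exact le_abs_self L
  have h1 : ν.real (Metric.closedBall x (2 * r)) ≤ ν.real (cap x (2 * (2 * r))) := by
    have h2 : ν.real (Metric.closedBall x (2 * r))
        = ν.real (Metric.closedBall x (2 * r) ∩ unitSphere d) := by
      refine measureReal_congr ?_
      filter_upwards [ae_withDensity_mem_unitSphere (w := w)] with y hy
      exact propext ⟨fun h => ⟨h, hy⟩, fun h => h.1⟩
    rw [h2]
    exact measureReal_mono (closedBall_inter_subset_cap hx _)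
  calc ν.real (Metric.closedBall x (2 * r)) ≤ ν.real (cap x (2 * (2 * r))) := h1
    _ ≤ |L| * ν.real (cap x (2 * r)) := hstep _ (by positivity)
    _ ≤ |L| * (|L| * ν.real (cap x r)) := by
        gcongr
        exact hstep r hr
    _ = |L| ^ 2 * ν.real (cap x r) := by ring
    _ ≤ _ := mul_le_mul_of_nonneg_left (measureReal_mono (cap_subset_closedBall hx r))
        (by positivity)

end Density

/-- τ_d-invariant Chebyshev-type cubature formulas for τ_d-invariant
doubling weights, with nodes off the coordinate planes. -/
theorem tau_invariant_chebyshev_cubature (d : ℕ) (hd : 2 ≤ d) (L : ℝ) :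
    ∃ K : ℝ, 0 < K ∧
      ∀ w : EuclideanSpace ℝ (Fin d) → ℝ,
        (∀ x, 0 ≤ w x) →
        Integrable w (sphMeasure d) →
        wMass w (unitSphere d) = 1 →
        (∀ x ∈ unitSphere d, ∀ r : ℝ, 0 < r →
          wMass w (cap x (2 * r)) ≤ L * wMass w (cap x r)) →
        (∀ x ∈ unitSphere d, w (lastNeg d x) = w x) →
        ∀ n N : ℕ, 0 < n → Even N →
          (∀ x ∈ unitSphere d, K ≤ (N : ℝ) * wMass w (cap x (1 / (n : ℝ)))) →
          ∃ Z : Finset (EuclideanSpace ℝ (Fin d)), Z.card = N ∧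
            (↑Z : Set (EuclideanSpace ℝ (Fin d))) ⊆ unitSphere d ∧
            (∀ P : MvPolynomial (Fin d) ℝ, P.totalDegree ≤ n →
              (∫ x, pEval P x * w x ∂(sphMeasure d))
                = (1 / (N : ℝ)) * ∑ z ∈ Z, pEval P z) ∧
            lastNeg d '' (↑Z : Set (EuclideanSpace ℝ (Fin d)))
              = (↑Z : Set (EuclideanSpace ℝ (Fin d))) ∧
            ∀ z ∈ Z, ∀ i : Fin d, z i ≠ 0 := by
  obtain ⟨s, hs⟩ := pow_unbounded_of_one_lt (|L| ^ 2) (one_lt_two (α := ℝ))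
  obtain ⟨δ, c, C, K, hC, hc, hδ1, hδ, hK, hnodes⟩ := exists_exact_nodes hd s
  refine ⟨2 * K, by positivity, fun w hw hwi hw1 hdbl hinv n N hn hN hmass => ?_⟩
  classical
  obtain ⟨k, rfl⟩ := hN
  have := isProbabilityMeasure_withDensity hw hwi hw1
  set ν := (sphMeasure d).withDensity fun x => ENNReal.ofReal (w x) with hν
  have hνS : ∀ᵐ y ∂ν, y ∈ unitSphere d := ae_withDensity_mem_unitSphere
  obtain ⟨R, z₀, z₁, hz₁S, hz₁R, hz₁ex, hdens⟩ := hnodes ν hνS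
    (fun x hx r hr => (measureReal_closedBall_two_mul_le hw hwi hw1 hdbl hx hr).trans
      (mul_le_mul_of_nonneg_right hs.le measureReal_nonneg)) n k hn
    (fun x hx => by
      have h1 := hmass x hx
      have h2 : wMass w (cap x (1 / n)) ≤ ν.real (Metric.closedBall x (1 / n)) := by
        rw [← measureReal_withDensity_eq_wMass hw hwi (measurableSet_cap x _)]
        exact measureReal_mono (cap_subset_closedBall hx _)
      have h3 : k * wMass w (cap x (1 / n)) ≤ k * ν.real (Metric.closedBall x (1 / n)) := by
        gcongr
      push_cast at h1
      linarith)
  obtain ⟨z, hzS, hz0, hzne, hzex⟩ := exists_generic_exact hd (I := (k : ℝ) • pIntegral ν hνS)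
    hn hC hc hδ1 hδ hdens hz₁S hz₁R hz₁ex
  have hk : (k : ℝ) ≠ 0 := by
    rintro hk0
    obtain ⟨x, hx⟩ := hνS.exists
    have := hmass x hx
    push_cast at this
    rw [hk0] at this
    linarith
  have hself : ∀ i, z i ≠ lastNeg d (z i) := by
    intro i h
    have h1 := congrArg (fun x : EuclideanSpace ℝ (Fin d) => x ⟨d - 1, by lia⟩) h
    simp only [lastNeg_apply, if_true] at h1
    exact hz0 i _ (self_eq_neg.1 h1)
  have hcross : ∀ i j, z i ≠ lastNeg d (z j) := by
    intro i j
    by_cases hij : i = j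
    · rw [← hij]
      exact hself i
    · exact (hzne i j hij).2
  have hinj : Function.Injective z := fun i j h => by
    by_contra hij
    exact (hzne i j hij).1 h
  set ζ : Fin k ⊕ Fin k → EuclideanSpace ℝ (Fin d) := Sum.elim z fun i => lastNeg d (z i) with hζ
  have hζinj : Function.Injective ζ :=
    hinj.sumElim (lastNeg_involutive.injective.comp hinj) hcross
  have hζS : ∀ p, ζ p ∈ unitSphere d := by
    rintro (i | i)
    · exact hzS i
    · exact lastNeg_mem_unitSphere.2 (hzS i)
  have hζneg : ∀ p, lastNeg d (ζ p) = ζ p.swap := by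
    rintro (i | i)
    · rfl
    · exact lastNeg_involutive (z i)
  refine ⟨Finset.univ.image ζ, ?_, ?_, fun P hP => ?_, ?_, ?_⟩
  · rw [Finset.card_image_of_injective _ hζinj]
    simp
  · rw [Finset.coe_image, Finset.coe_univ, image_univ]
    exact range_subset_iff.2 hζS
  · have hI : pIntegral ν hνS (polyLastNeg P) = pIntegral ν hνS P := by
      change ∫ x, pEval (polyLastNeg P) x ∂ν = ∫ x, pEval P x ∂ν
      rw [integral_withDensity_eq hw hwi, integral_withDensity_eq hw hwi,
        ← integral_comp_lastNeg fun x => pEval P x * w x]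
      refine integral_congr_ae ?_
      filter_upwards [ae_mem_unitSphere] with x hx
      rw [pEval_polyLastNeg, hinv x hx]
    have h1 := hzex P hP
    have h2 := hzex (polyLastNeg P) (totalDegree_polyLastNeg_le hP)
    rw [LinearMap.smul_apply, smul_eq_mul] at h1 h2
    simp only [pEval_polyLastNeg] at h2
    rw [Finset.sum_image hζinj.injOn, Fintype.sum_sum_type]
    simp only [hζ, Sum.elim_inl, Sum.elim_inr]
    rw [h1, h2, hI, ← integral_withDensity_eq hw hwi]
    change pIntegral ν hνS P = _
    push_cast
    field_simp
  · rw [Finset.coe_image, Finset.coe_univ, image_univ, ← range_comp]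
    have h1 : lastNeg d ∘ ζ = ζ ∘ Sum.swap := funext hζneg
    rw [h1]
    exact (Equiv.sumComm (Fin k) (Fin k)).surjective.range_comp ζ
  · intro u hu a
    obtain ⟨p, -, rfl⟩ := Finset.mem_image.1 hu
    rcases p with i | i
    · exact hz0 i a
    · simp only [hζ, Sum.elim_inr, lastNeg_apply]
      split_ifs
      · exact neg_ne_zero.2 (hz0 i a)
      · exact hz0 i a
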